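/- arXiv:2311.07382 — 3 statements merged into one kernel-verified Lean document; each statement's English description precedes it below -/
import Mathlib

section
/- For the cylindric diagram D on a 3-row cylinder whose shape consists of a 2x2 block in the top two rows plus one box below the right column of that block (with cylindrical wrapping as described), the power-sum expansion of the cylindric Schur function is s_D(x) = -p_5/z_5 + 2 p_{41}/z_{41} - 2 p_{311}/z_{311} + 4 p_{11111}/z_{11111}; in particular the coefficients of p_{221} and p_{2111} vanish. -/
/-!
STATEMENT 10: The power-sum expansion of the cylindric Schur function of the
5-box cylindric diagram `D` of Example `ex:mnrule`.  On the cylinder `C_{2,2}`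
(cells `(i,j) ≡ (i+2, j+2)`), `D` has boundary loops `lam i = i + 1 + (i mod 2)`
and `mu i = i - 1`; its fundamental domain (rows `1,2`) consists of row 1 with
columns `{1,2,3}` and row 2 with columns `{2,3}` — the `2×2` block in the top
two rows plus the box below the right column, cylindrically glued.  The claim:
`s_D = -p_5/z_5 + 2 p_{41}/z_{41} - 2 p_{311}/z_{311} + 4 p_{11111}/z_{11111}`
(with `z_5 = 5`, `z_{41} = 4`, `z_{311} = 6`, `z_{11111} = 120`); in particular
the coefficients of `p_{221}` and `p_{2111}` vanish.
-/

open scoped Classical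

/-- `(i,j)` is a cell of the cylindric diagram with boundaries `lam`, `mu`. -/
def CylCell (lam mu : ℤ → ℤ) (c : ℤ × ℤ) : Prop :=
  mu c.1 < c.2 ∧ c.2 ≤ lam c.1

/-- Cylindric semistandard Young tableau on `C_{x,y}` (no weight condition). -/
def IsCylSSYT (x y : ℕ) (lam mu : ℤ → ℤ) (T : ℤ × ℤ → ℕ) : Prop :=
  (∀ c, ¬ CylCell lam mu c → T c = 0) ∧
  (∀ i j : ℤ, T (i + y, j + x) = T (i, j)) ∧
  (∀ c, CylCell lam mu c → 0 < T c) ∧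
  (∀ i j : ℤ, CylCell lam mu (i, j) → CylCell lam mu (i, j + 1) →
    T (i, j) ≤ T (i, j + 1)) ∧
  (∀ i j : ℤ, CylCell lam mu (i, j) → CylCell lam mu (i + 1, j) →
    T (i + 1, j) < T (i, j))

/-- The cylindric skew Schur function of the diagram `(x,y,lam,mu)`, as a
formal power series in the variables `x_n`, `n : ℕ+`: the coefficient of a
monomial `d` is the number of cylindric SSYT whose fundamental domain contains
exactly `d v` entries equal to `v`. -/
noncomputable def cylSchur (x y : ℕ) (lam mu : ℤ → ℤ) :
    MvPowerSeries ℕ+ ℚ :=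
  fun d => (Nat.card {T : ℤ × ℤ → ℕ // IsCylSSYT x y lam mu T ∧
    ∀ v : ℕ+, Nat.card {c : ℤ × ℤ // 0 ≤ c.1 ∧ c.1 < (y : ℤ) ∧
      CylCell lam mu c ∧ T c = (v : ℕ)} = d v} : ℚ)

/-- The power-sum symmetric function `p_k` as a power series in `x_n`, `n : ℕ+`. -/
noncomputable def powerSum (k : ℕ) : MvPowerSeries ℕ+ ℚ :=
  fun d => if ∃ i : ℕ+, d = Finsupp.single i k then 1 else 0

/-! ### Generating functions of weighted families -/

section GenFun

variable {α β : Type*}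

/-- The generating function `∑ a, x ^ φ a` of a family of monomials with finite fibres. -/
noncomputable def genFun (φ : α → ℕ+ →₀ ℕ) : MvPowerSeries ℕ+ ℚ :=
  fun d => (Nat.card {a // φ a = d} : ℚ)

theorem coeff_genFun (φ : α → ℕ+ →₀ ℕ) (d : ℕ+ →₀ ℕ) :
    MvPowerSeries.coeff d (genFun φ) = (Nat.card {a // φ a = d} : ℚ) :=
  rfl

theorem genFun_congr {φ : α → ℕ+ →₀ ℕ} {ψ : β → ℕ+ →₀ ℕ} (e : α ≃ β)
    (h : ∀ a, ψ (e a) = φ a) : genFun φ = genFun ψ := by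
  ext d
  rw [coeff_genFun, coeff_genFun,
    Nat.card_congr (e.subtypeEquiv (q := fun b => ψ b = d) fun a => by rw [h])]

/-- The fibre of a sum of two weights, sorted by the two summands. -/
def fiberAddEquiv (φ : α → ℕ+ →₀ ℕ) (ψ : β → ℕ+ →₀ ℕ) (d : ℕ+ →₀ ℕ) :
    {x : α × β // φ x.1 + ψ x.2 = d} ≃
      Σ p : Finset.HasAntidiagonal.antidiagonal d, {a // φ a = p.1.1} × {b // ψ b = p.1.2} where
  toFun x := ⟨⟨(φ x.1.1, ψ x.1.2), Finset.HasAntidiagonal.mem_antidiagonal.2 x.2⟩,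
    ⟨x.1.1, rfl⟩, ⟨x.1.2, rfl⟩⟩
  invFun y := ⟨(y.2.1, y.2.2), by
    rw [y.2.1.2, y.2.2.2]; exact Finset.HasAntidiagonal.mem_antidiagonal.1 y.1.2⟩
  left_inv _ := rfl
  right_inv := by
    rintro ⟨⟨⟨p, q⟩, h⟩, ⟨a, rfl : φ a = p⟩, ⟨b, rfl : ψ b = q⟩⟩
    rfl

theorem finite_fiber_add {φ : α → ℕ+ →₀ ℕ} {ψ : β → ℕ+ →₀ ℕ}
    (hφ : ∀ d, Finite {a // φ a = d}) (hψ : ∀ d, Finite {b // ψ b = d}) (d : ℕ+ →₀ ℕ) :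
    Finite {x : α × β // φ x.1 + ψ x.2 = d} :=
  Finite.of_equiv _ (fiberAddEquiv φ ψ d).symm

theorem genFun_mul {φ : α → ℕ+ →₀ ℕ} {ψ : β → ℕ+ →₀ ℕ}
    (hφ : ∀ d, Finite {a // φ a = d}) (hψ : ∀ d, Finite {b // ψ b = d}) :
    genFun φ * genFun ψ = genFun fun x : α × β => φ x.1 + ψ x.2 := by
  ext d
  rw [MvPowerSeries.coeff_mul, coeff_genFun, Nat.card_congr (fiberAddEquiv φ ψ d),
    Nat.card_sigma, ← Finset.sum_coe_sort]
  simp only [coeff_genFun, Nat.card_prod, Nat.cast_sum, Nat.cast_mul]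

theorem finite_fiber_single {k : ℕ} (hk : k ≠ 0) (d : ℕ+ →₀ ℕ) :
    Finite {i : ℕ+ // Finsupp.single i k = d} :=
  have : Subsingleton {i : ℕ+ // Finsupp.single i k = d} :=
    ⟨fun i j => Subtype.ext (Finsupp.single_left_injective hk (i.2.trans j.2.symm))⟩
  inferInstance

theorem powerSum_eq_genFun {k : ℕ} (hk : k ≠ 0) :
    powerSum k = genFun fun i : ℕ+ => Finsupp.single i k := by
  ext d
  rw [coeff_genFun]
  change (if ∃ i : ℕ+, d = Finsupp.single i k then (1 : ℚ) else 0) = _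
  split_ifs with h
  · obtain ⟨i, rfl⟩ := h
    have : Unique {j : ℕ+ // Finsupp.single j k = Finsupp.single i k} :=
      { default := ⟨i, rfl⟩
        uniq := fun j => Subtype.ext (Finsupp.single_left_injective hk j.2) }
    simp
  · have : IsEmpty {i : ℕ+ // Finsupp.single i k = d} := ⟨fun i => h ⟨i, i.2.symm⟩⟩
    simp

end GenFun

/-! ### Words of length five -/

/-- The content of a word: the number of occurrences of each letter. -/
noncomputable def content (t : Fin 5 → ℕ+) : ℕ+ →₀ ℕ :=
  ∑ i, Finsupp.single (t i) 1

theorem content_apply (t : Fin 5 → ℕ+) (v : ℕ+) :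
    content t v = Nat.card {i // t i = v} := by
  simp [content, Finsupp.finsetSum_apply, Finsupp.single_apply, Fintype.card_subtype]

theorem content_comp_perm (t : Fin 5 → ℕ+) (σ : Equiv.Perm (Fin 5)) :
    content (t ∘ σ) = content t :=
  Equiv.sum_comp σ fun i => Finsupp.single (t i) 1

theorem finite_content_fiber (d : ℕ+ →₀ ℕ) : Finite {t // content t = d} := by
  refine Set.Finite.subset (Set.Finite.pi' fun _ : Fin 5 => d.support.finite_toSet) ?_
  rintro t rfl i
  simp only [Finset.mem_coe, Finsupp.mem_support_iff, content_apply]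
  have : Nonempty {j // t j = t i} := ⟨⟨i, rfl⟩⟩
  exact Nat.card_pos.ne'

theorem coeff_genFun_content (p : (Fin 5 → ℕ+) → Prop) [DecidablePred p] (d : ℕ+ →₀ ℕ)
    [Fintype {t // content t = d}] :
    MvPowerSeries.coeff d (genFun fun t : {t // p t} => content t) =
      ∑ t : {t // content t = d}, if p t then 1 else 0 := by
  rw [coeff_genFun, Finset.sum_boole, ← Fintype.card_subtype, ← Nat.card_eq_fintype_card]
  exact congrArg _ (Nat.card_congr (Equiv.subtypeSubtypeEquivSubtypeInter p (content · = d)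
    |>.trans (Equiv.subtypeEquivRight fun _ => and_comm)
    |>.trans (Equiv.subtypeSubtypeEquivSubtypeInter (content · = d) p).symm))

theorem powerSum_five_eq_genFun :
    powerSum 5 = genFun fun
      t : {t : Fin 5 → ℕ+ // t 0 = t 1 ∧ t 1 = t 2 ∧ t 2 = t 3 ∧ t 3 = t 4} =>
      content t := by
  rw [powerSum_eq_genFun (by norm_num)]
  refine genFun_congr
    { toFun := fun a => ⟨![a, a, a, a, a], by simp⟩
      invFun := fun t => t.1 0
      left_inv := fun _ => rfl
      right_inv := ?_ } ?_
  · rintro ⟨t, h0, h1, h2, h3⟩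
    ext i; fin_cases i <;> simp [h0, h1, h2, h3]
  · intro a
    change content ![a, a, a, a, a] = _
    simp [content, Fin.sum_univ_five, ← Finsupp.single_add]

theorem powerSum_four_one_eq_genFun :
    powerSum 4 * powerSum 1 =
      genFun fun t : {t : Fin 5 → ℕ+ // t 0 = t 1 ∧ t 1 = t 2 ∧ t 2 = t 3} => content t := by
  rw [powerSum_eq_genFun (by norm_num), powerSum_eq_genFun (by norm_num),
    genFun_mul (finite_fiber_single (by norm_num)) (finite_fiber_single (by norm_num))]
  refine genFun_congr
    { toFun := fun x => ⟨![x.1, x.1, x.1, x.1, x.2], by simp⟩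
      invFun := fun t => (t.1 0, t.1 4)
      left_inv := fun _ => rfl
      right_inv := ?_ } ?_
  · rintro ⟨t, h0, h1, h2⟩
    ext i; fin_cases i <;> simp [h0, h1, h2]
  · intro x
    change content ![x.1, x.1, x.1, x.1, x.2] = _
    simp [content, Fin.sum_univ_five, ← Finsupp.single_add]

theorem powerSum_three_one_one_eq_genFun :
    powerSum 3 * powerSum 1 * powerSum 1 =
      genFun fun t : {t : Fin 5 → ℕ+ // t 0 = t 1 ∧ t 1 = t 2} => content t := by
  have h1 := finite_fiber_single one_ne_zero
  have h3 := finite_fiber_single three_ne_zero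
  rw [powerSum_eq_genFun one_ne_zero, powerSum_eq_genFun three_ne_zero, genFun_mul h3 h1,
    genFun_mul (finite_fiber_add h3 h1) h1]
  refine genFun_congr
    { toFun := fun x => ⟨![x.1.1, x.1.1, x.1.1, x.1.2, x.2], by simp⟩
      invFun := fun t => ((t.1 0, t.1 3), t.1 4)
      left_inv := fun _ => rfl
      right_inv := ?_ } ?_
  · rintro ⟨t, h0, h1⟩
    ext i; fin_cases i <;> simp [h0, h1]
  · intro x
    change content ![x.1.1, x.1.1, x.1.1, x.1.2, x.2] = _
    simp [content, Fin.sum_univ_five, ← Finsupp.single_add]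

theorem powerSum_one_pow_five_eq_genFun :
    powerSum 1 * powerSum 1 * powerSum 1 * powerSum 1 * powerSum 1 =
      genFun fun t : {_t : Fin 5 → ℕ+ // True} => content t := by
  have h := finite_fiber_single one_ne_zero
  have h2 := finite_fiber_add h h
  have h3 := finite_fiber_add h2 h
  rw [powerSum_eq_genFun one_ne_zero, genFun_mul h h, genFun_mul h2 h, genFun_mul h3 h,
    genFun_mul (finite_fiber_add h3 h) h]
  refine genFun_congr
    { toFun := fun x => ⟨![x.1.1.1.1, x.1.1.1.2, x.1.1.2, x.1.2, x.2], trivial⟩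
      invFun := fun t => ((((t.1 0, t.1 1), t.1 2), t.1 3), t.1 4)
      left_inv := fun _ => rfl
      right_inv := ?_ } ?_
  · rintro ⟨t, -⟩
    ext i; fin_cases i <;> simp
  · intro x
    change content ![x.1.1.1.1, x.1.1.1.2, x.1.1.2, x.1.2, x.2] = _
    simp [content, Fin.sum_univ_five]

/-! ### The symmetrized identity -/

section Symmetrization

variable {α β : Type*} [LinearOrder α] [LinearOrder β]

/-- The row and column conditions on the entries of a filling of the fundamental domain, read
along the first row (`t 0`, `t 1`) and then along the second row (`t 2`, `t 3`, `t 4`). -/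
def IsReadingWord (t : Fin 5 → α) : Prop :=
  (t 0 ≤ t 1 ∧ t 2 ≤ t 3 ∧ t 3 ≤ t 4) ∧ t 0 < t 3 ∧ t 1 < t 4 ∧ t 2 < t 1

instance (t : Fin 5 → α) : Decidable (IsReadingWord t) := by
  unfold IsReadingWord; infer_instance

/-- Thirty times the contribution of a word to the difference of the two sides of the power-sum
expansion. -/
def defect (t : Fin 5 → α) : ℤ :=
  30 * (if IsReadingWord t then 1 else 0)
    + 6 * (if t 0 = t 1 ∧ t 1 = t 2 ∧ t 2 = t 3 ∧ t 3 = t 4 then 1 else 0)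
    - 15 * (if t 0 = t 1 ∧ t 1 = t 2 ∧ t 2 = t 3 then 1 else 0)
    + 10 * (if t 0 = t 1 ∧ t 1 = t 2 then 1 else 0) - 1

theorem defect_congr {t : Fin 5 → α} {u : Fin 5 → β} (h : ∀ i j, t i ≤ t j ↔ u i ≤ u j) :
    defect t = defect u := by
  have hlt : ∀ i j, t i < t j ↔ u i < u j := fun i j => by simp only [← not_le, h]
  have heq : ∀ i j, t i = t j ↔ u i = u j := fun i j => by simp only [le_antisymm_iff, h]
  simp only [defect, IsReadingWord, h, hlt, heq]

/-- The weakly increasing word starting at `0` with the given steps. -/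
def stepWord (p q r s : Fin 2) : Fin 5 → ℕ :=
  ![0, p, p + q, p + q + r, p + q + r + s]

theorem exists_stepWord {t : Fin 5 → α} (ht : Monotone t) :
    ∃ p q r s, ∀ i j, t i ≤ t j ↔ stepWord p q r s i ≤ stepWord p q r s j := by
  have h0 : t 0 ≤ t 1 := ht (by decide)
  have h1 : t 1 ≤ t 2 := ht (by decide)
  have h2 : t 2 ≤ t 3 := ht (by decide)
  have h3 : t 3 ≤ t 4 := ht (by decide)
  refine ⟨if t 0 < t 1 then 1 else 0, if t 1 < t 2 then 1 else 0, if t 2 < t 3 then 1 else 0,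
    if t 3 < t 4 then 1 else 0, fun i j => ?_⟩
  fin_cases i <;> fin_cases j <;> simp [stepWord] <;> grind

theorem sum_defect_stepWord : ∀ p q r s : Fin 2,
    ∑ σ : Equiv.Perm (Fin 5), defect (stepWord p q r s ∘ σ) = 0 := by
  decide +kernel

theorem sum_defect_comp_perm (t : Fin 5 → α) :
    ∑ σ : Equiv.Perm (Fin 5), defect (t ∘ σ) = 0 := by
  obtain ⟨p, q, r, s, h⟩ := exists_stepWord (Tuple.monotone_sort t)
  rw [← Equiv.sum_comp (Equiv.mulLeft (Tuple.sort t)), ← sum_defect_stepWord p q r s]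
  exact Finset.sum_congr rfl fun σ _ => defect_congr fun i j => h (σ i) (σ j)

end Symmetrization

theorem sum_defect_content_fiber (d : ℕ+ →₀ ℕ) [Fintype {t // content t = d}] :
    ∑ t : {t // content t = d}, defect t.1 = 0 := by
  have hσ (σ : Equiv.Perm (Fin 5)) :
      ∑ t : {t // content t = d}, defect (t.1 ∘ σ) = ∑ t : {t // content t = d}, defect t.1 :=
    Equiv.sum_comp ((σ.arrowCongr (Equiv.refl ℕ+)).symm.subtypeEquiv fun t => by
      rw [← content_comp_perm t σ]; rfl) fun t : {t // content t = d} => defect t.1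
  have h : ∑ σ : Equiv.Perm (Fin 5), ∑ t : {t // content t = d}, defect (t.1 ∘ σ) = 0 := by
    rw [Finset.sum_comm]
    exact Finset.sum_eq_zero fun t _ => sum_defect_comp_perm t.1
  simpa [hσ, Fintype.card_perm, Nat.factorial_ne_zero] using h

/-! ### Cylindric tableaux as words -/

/-- The lower right boundary of the diagram. -/
abbrev exLam : ℤ → ℤ := fun i => i + 1 + i % 2

/-- The upper left boundary of the diagram. -/
abbrev exMu : ℤ → ℤ := fun i => i - 1

/-- The cells of the fundamental domain in reading order. -/
def domainCell : Fin 5 → ℤ × ℤ :=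
  ![(0, 0), (0, 1), (1, 1), (1, 2), (1, 3)]

theorem cylCell_exLam_exMu_iff (c : ℤ × ℤ) :
    CylCell exLam exMu c ↔ c.1 - 1 < c.2 ∧ c.2 ≤ c.1 + 1 + c.1 % 2 :=
  Iff.rfl

theorem cylCell_domainCell (i : Fin 5) : CylCell exLam exMu (domainCell i) := by
  fin_cases i <;> simp [cylCell_exLam_exMu_iff, domainCell]

theorem domainCell_injective : Function.Injective domainCell := by
  decide

theorem domainCell_fst_mem :
    ∀ i : Fin 5, 0 ≤ (domainCell i).1 ∧ (domainCell i).1 < 2 := by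
  decide

theorem exists_domainCell {c : ℤ × ℤ} (hc : CylCell exLam exMu c) :
    ∃ (m : ℤ) (i : Fin 5), c = ((domainCell i).1 + m * 2, (domainCell i).2 + m * 2) := by
  obtain ⟨i, j⟩ := c
  simp only [cylCell_exLam_exMu_iff] at hc
  refine ⟨i / 2, ?_⟩
  simp only [Fin.exists_fin_succ, domainCell]
  simp
  omega

/-- The periodic filling of the diagram with a given reading word. -/
def fillWord (t : Fin 5 → ℕ+) (c : ℤ × ℤ) : ℕ :=
  if c.1 % 2 = 0 then
    if c.2 = c.1 then t 0 else if c.2 = c.1 + 1 then t 1 else 0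
  else
    if c.2 = c.1 then t 2 else if c.2 = c.1 + 1 then t 3 else if c.2 = c.1 + 2 then t 4 else 0

theorem fillWord_domainCell (t : Fin 5 → ℕ+) (i : Fin 5) : fillWord t (domainCell i) = t i := by
  fin_cases i <;> simp [fillWord, domainCell]

theorem fillWord_add_period (t : Fin 5 → ℕ+) (i j : ℤ) :
    fillWord t (i + 2, j + 2) = fillWord t (i, j) := by
  have h0 : (j + 2 = i + 2) = (j = i) := by simp
  have h1 : (j + 2 = i + 2 + 1) = (j = i + 1) := by simp; omega
  have h2 : (j + 2 = i + 2 + 2) = (j = i + 2) := by simp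
  simp only [fillWord, Int.add_emod_right, h0, h1, h2]

theorem isCylSSYT_fillWord {t : Fin 5 → ℕ+} (ht : IsReadingWord t) :
    IsCylSSYT 2 2 exLam exMu (fillWord t) := by
  obtain ⟨⟨h01, h23, h34⟩, h03, h14, h21⟩ := ht
  simp only [← PNat.coe_le_coe, ← PNat.coe_lt_coe] at h01 h23 h34 h03 h14 h21
  refine ⟨fun c hc => ?_, fillWord_add_period t, fun c hc => ?_, fun i j h h' => ?_,
    fun i j h h' => ?_⟩
  · simp only [cylCell_exLam_exMu_iff] at hc
    simp only [fillWord]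
    split_ifs <;> omega
  · have := fun i => (t i).pos
    simp only [cylCell_exLam_exMu_iff] at hc
    simp only [fillWord]
    split_ifs <;> first | exact this _ | omega
  · simp only [cylCell_exLam_exMu_iff] at h h'
    simp only [fillWord]
    split_ifs <;> omega
  · simp only [cylCell_exLam_exMu_iff] at h h'
    simp only [fillWord]
    split_ifs <;> omega

namespace IsCylSSYT

variable {T : ℤ × ℤ → ℕ}

theorem apply_add_period (hT : IsCylSSYT 2 2 exLam exMu T) (i j m : ℤ) :
    T (i + m * 2, j + m * 2) = T (i, j) := by
  have h : Function.Periodic (fun n : ℤ => T (i + n, j + n)) 2 := fun n => by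
    simpa only [add_assoc, Nat.cast_ofNat] using hT.2.1 (i + n) (j + n)
  simpa using h.int_mul m 0

theorem pos_domainCell (hT : IsCylSSYT 2 2 exLam exMu T) (i : Fin 5) : 0 < T (domainCell i) :=
  hT.2.2.1 _ (cylCell_domainCell i)

/-- The reading word of the fundamental domain of a cylindric tableau. -/
def readingWord (hT : IsCylSSYT 2 2 exLam exMu T) (i : Fin 5) : ℕ+ :=
  ⟨T (domainCell i), hT.pos_domainCell i⟩

theorem isReadingWord (hT : IsCylSSYT 2 2 exLam exMu T) : IsReadingWord hT.readingWord := by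
  have h13 : T (-1, 0) = T (1, 2) := (hT.apply_add_period (-1) 0 1).symm
  have h14 : T (-1, 1) = T (1, 3) := (hT.apply_add_period (-1) 1 1).symm
  obtain ⟨-, -, -, hrow, hcol⟩ := hT
  refine ⟨⟨hrow 0 0 ?_ ?_, hrow 1 1 ?_ ?_, hrow 1 2 ?_ ?_⟩, (hcol (-1) 0 ?_ ?_).trans_eq h13,
    (hcol (-1) 1 ?_ ?_).trans_eq h14, hcol 0 1 ?_ ?_⟩ <;> norm_num [cylCell_exLam_exMu_iff]

theorem fillWord_readingWord (hT : IsCylSSYT 2 2 exLam exMu T) : fillWord hT.readingWord = T := by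
  have hF := isCylSSYT_fillWord hT.isReadingWord
  funext c
  by_cases hc : CylCell exLam exMu c
  · obtain ⟨m, i, rfl⟩ := exists_domainCell hc
    rw [hF.apply_add_period, hT.apply_add_period]
    exact fillWord_domainCell _ i
  · rw [hF.1 c hc, hT.1 c hc]

theorem card_domain_eq (hT : IsCylSSYT 2 2 exLam exMu T) (v : ℕ+) :
    Nat.card {c : ℤ × ℤ // 0 ≤ c.1 ∧ c.1 < ((2 : ℕ) : ℤ) ∧ CylCell exLam exMu c ∧ T c = (v : ℕ)} =
      content hT.readingWord v := by
  rw [content_apply]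
  symm
  refine Nat.card_eq_of_bijective (fun i : {i // hT.readingWord i = v} => ⟨domainCell i,
    (domainCell_fst_mem i).1, (domainCell_fst_mem i).2, cylCell_domainCell i,
    congrArg PNat.val i.2⟩) ⟨fun i j h => ?_, ?_⟩
  · exact Subtype.ext (domainCell_injective (congrArg Subtype.val h))
  · rintro ⟨c, h0, h2, hc, hv⟩
    obtain ⟨m, i, rfl⟩ := exists_domainCell hc
    have hm : m = 0 := by
      have := domainCell_fst_mem i
      simp only at h0 h2
      omega
    subst hm
    simp only [zero_mul, add_zero] at hv ⊢
    exact ⟨⟨i, PNat.eq hv⟩, rfl⟩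

end IsCylSSYT

/-- Cylindric tableaux of the diagram are determined by their reading words. -/
def cylSSYTEquiv :
    {T // IsCylSSYT 2 2 exLam exMu T} ≃ {t : Fin 5 → ℕ+ // IsReadingWord t} where
  toFun T := ⟨T.2.readingWord, T.2.isReadingWord⟩
  invFun t := ⟨fillWord t, isCylSSYT_fillWord t.2⟩
  left_inv T := Subtype.ext T.2.fillWord_readingWord
  right_inv t := Subtype.ext (funext fun i => PNat.eq (fillWord_domainCell t i))

theorem cylSchur_eq_genFun :
    cylSchur 2 2 exLam exMu = genFun fun t : {t : Fin 5 → ℕ+ // IsReadingWord t} => content t := by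
  ext d
  have h (T : {T // IsCylSSYT 2 2 exLam exMu T}) :
      (∀ v : ℕ+, Nat.card {c : ℤ × ℤ // 0 ≤ c.1 ∧ c.1 < ((2 : ℕ) : ℤ) ∧ CylCell exLam exMu c ∧
        T.1 c = (v : ℕ)} = d v) ↔ content (cylSSYTEquiv T).1 = d := by
    simp only [T.2.card_domain_eq, DFunLike.ext_iff]
    rfl
  rw [coeff_genFun, ← Nat.card_congr (cylSSYTEquiv.subtypeEquiv h),
    Nat.card_congr (Equiv.subtypeSubtypeEquivSubtypeInter (IsCylSSYT 2 2 exLam exMu) fun T =>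
      ∀ v : ℕ+, Nat.card {c : ℤ × ℤ // 0 ≤ c.1 ∧ c.1 < ((2 : ℕ) : ℤ) ∧ CylCell exLam exMu c ∧
        T c = (v : ℕ)} = d v)]
  rfl

theorem cylindric_MN_example :
    cylSchur 2 2 (fun i => i + 1 + i % 2) (fun i => i - 1)
      = (-(1 : ℚ) / 5) • powerSum 5
        + ((2 : ℚ) / 4) • (powerSum 4 * powerSum 1)
        + (-(2 : ℚ) / 6) • (powerSum 3 * powerSum 1 * powerSum 1)
        + ((0 : ℚ) / 12) • (powerSum 2 * powerSum 2 * powerSum 1)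
        + ((0 : ℚ) / 8) • (powerSum 2 * powerSum 1 * powerSum 1 * powerSum 1)
        + ((4 : ℚ) / 120) •
            (powerSum 1 * powerSum 1 * powerSum 1 * powerSum 1 * powerSum 1) := by
  change cylSchur 2 2 exLam exMu = _
  rw [cylSchur_eq_genFun, powerSum_five_eq_genFun, powerSum_four_one_eq_genFun,
    powerSum_three_one_one_eq_genFun, powerSum_one_pow_five_eq_genFun]
  ext d
  have := finite_content_fiber d
  have := Fintype.ofFinite {t // content t = d}
  have h : ((∑ t : {t // content t = d}, defect t.1 : ℤ) : ℚ) = 0 := by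
    rw [sum_defect_content_fiber, Int.cast_zero]
  simp only [defect, Finset.sum_add_distrib, Finset.sum_sub_distrib, ← Finset.mul_sum,
    Int.cast_add, Int.cast_sub, Int.cast_mul, Int.cast_sum, Int.cast_ite, Int.cast_one,
    Int.cast_zero, Int.cast_ofNat] at h
  simp only [map_add, map_smul, coeff_genFun_content, smul_eq_mul, if_true]
  linarith
end

section
/- Flagged Jacobi–Trudi identity: for a skew shape lambda/mu with l rows and weakly increasing flags a = (a_1,...,a_l), b = (b_1,...,b_l), the row-flagged skew Schur polynomial satisfies s_{lambda/mu}(a,b) = det( h_{lambda_i - mu_j - i + j}(a_j, b_i) )_{1<=i,j<=l}, where h_m(a,b) is the complete homogeneous polynomial of degree m in variables x_a,...,x_b (with h_0 = 1 and h_m = 0 for m < 0). -/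
/-!
STATEMENT 11: Flagged Jacobi–Trudi identity (Gessel, Wachs).
For a skew shape `lam/mu` with `l` rows and weakly increasing flags `a`, `b`,
the row-flagged skew Schur polynomial equals
`det( h_{lam_i - mu_j - i + j}(a_j, b_i) )_{1 ≤ i,j ≤ l}`.
-/

open MvPolynomial

open scoped Classical in
/-- The complete homogeneous polynomial of degree `m` in variables
`x_a, …, x_b` (`1` for `m = 0`). -/
noncomputable def hFlag (m a b : ℕ) : MvPolynomial ℕ ℚ :=
  ∑ f : Fin m → Fin (b + 1),
    if Monotone f ∧ ∀ i, a ≤ (f i : ℕ) then ∏ i, X ((f i : ℕ)) else 0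

/-- `hFlag` with an integer degree: `0` whenever the degree is negative. -/
noncomputable def hFlagZ (m : ℤ) (a b : ℕ) : MvPolynomial ℕ ℚ :=
  if 0 ≤ m then hFlag m.toNat a b else 0

/-- Cells of the skew diagram `lam/mu` (row `i`, columns `mu i < j ≤ lam i`),
collected in a finite set. -/
def skewCells {l : ℕ} (lam mu : Fin l → ℕ) : Finset (Fin l × ℕ) :=
  (Finset.univ ×ˢ Finset.range (∑ i, lam i + 1)).filter
    (fun c => mu c.1 < c.2 ∧ c.2 ≤ lam c.1)

open scoped Classical in
/-- The row-flagged skew Schur polynomial: the sum of `x^T` over all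
semistandard Young tableaux of shape `lam/mu` whose entries in row `i` lie in
`{a i, …, b i}`. -/
noncomputable def flaggedSchur {l : ℕ} (lam mu a b : Fin l → ℕ) :
    MvPolynomial ℕ ℚ :=
  ∑ T : {c // c ∈ skewCells lam mu} → Fin (∑ i, b i + 1),
    if ((∀ c c' : {c // c ∈ skewCells lam mu},
          c'.1.1 = c.1.1 → c'.1.2 = c.1.2 + 1 → (T c : ℕ) ≤ T c') ∧
        (∀ c c' : {c // c ∈ skewCells lam mu},
          (c'.1.1 : ℕ) = (c.1.1 : ℕ) + 1 → c'.1.2 = c.1.2 → (T c : ℕ) < T c') ∧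
        (∀ c : {c // c ∈ skewCells lam mu},
          a c.1.1 ≤ (T c : ℕ) ∧ (T c : ℕ) ≤ b c.1.1))
    then ∏ c, X ((T c : ℕ)) else 0

/-- The cells of the skew diagram with rows `i < l` and columns `mu i < c ≤ lam i`. -/
def natCells (l : ℕ) (lam mu : ℕ → ℕ) : Finset (ℕ × ℕ) :=
  (Finset.range l ×ˢ Finset.range (∑ i ∈ Finset.range l, lam i + 1)).filter
    (fun p => mu p.1 < p.2 ∧ p.2 ≤ lam p.1)

lemma mem_natCells {l : ℕ} {lam mu : ℕ → ℕ} {p : ℕ × ℕ} :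
    p ∈ natCells l lam mu ↔ p.1 < l ∧ mu p.1 < p.2 ∧ p.2 ≤ lam p.1 := by
  simp only [natCells, Finset.mem_filter, Finset.mem_product, Finset.mem_range]
  refine ⟨fun h => ⟨h.1.1, h.2⟩, fun h => ⟨⟨h.1, ?_⟩, h.2⟩⟩
  have := Finset.single_le_sum (f := lam) (fun _ _ => Nat.zero_le _) (Finset.mem_range.2 h.1)
  omega

/-- Row-flagged semistandard tableaux, extended by zero outside the diagram; the entries of
row `i` lie in the half-open interval `[a i, b i)`. -/
structure IsFlaggedTableau (l : ℕ) (lam mu a b : ℕ → ℕ) (T : ℕ × ℕ → ℕ) : Prop where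
  supp : ∀ i c, ¬ (i < l ∧ mu i < c ∧ c ≤ lam i) → T (i, c) = 0
  row : ∀ i c, i < l → mu i < c → c + 1 ≤ lam i → T (i, c) ≤ T (i, c + 1)
  col : ∀ i c, i + 1 < l → mu i < c → c ≤ lam i → mu (i + 1) < c → c ≤ lam (i + 1) →
    T (i, c) < T (i + 1, c)
  flag : ∀ i c, i < l → mu i < c → c ≤ lam i → a i ≤ T (i, c) ∧ T (i, c) < b i

/-- The generating polynomial of flagged tableaux with half-open flags. -/
noncomputable def tableauSum (l : ℕ) (lam mu a b : ℕ → ℕ) : MvPolynomial ℕ ℚ :=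
  ∑ᶠ T ∈ {T | IsFlaggedTableau l lam mu a b T}, ∏ p ∈ natCells l lam mu, X (T p)

lemma finite_isFlaggedTableau (l : ℕ) (lam mu a b : ℕ → ℕ) :
    {T | IsFlaggedTableau l lam mu a b T}.Finite := by
  refine Set.Finite.of_injOn (f := fun T (p : natCells l lam mu) => T p.1)
    (t := Set.pi Set.univ fun p => Set.Iio (b p.1.1)) ?_ ?_
    (Set.Finite.pi fun p => Set.finite_Iio _)
  · rintro T hT ⟨⟨i, c⟩, hp⟩ -
    have h := mem_natCells.1 hp
    exact (hT.flag i c h.1 h.2.1 h.2.2).2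
  · intro T hT T' hT' h
    ext ⟨i, c⟩
    by_cases hp : (i, c) ∈ natCells l lam mu
    · exact congrFun h ⟨_, hp⟩
    · rw [mem_natCells] at hp
      rw [hT.supp i c hp, hT'.supp i c hp]

lemma tableauSum_congr {l l' : ℕ} {lam mu a b lam' mu' a' b' : ℕ → ℕ}
    (hc : natCells l lam mu = natCells l' lam' mu')
    (h : ∀ T, IsFlaggedTableau l lam mu a b T ↔ IsFlaggedTableau l' lam' mu' a' b' T) :
    tableauSum l lam mu a b = tableauSum l' lam' mu' a' b' := by
  simp only [tableauSum, hc, h]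

lemma tableauSum_congr_of_eqOn {l : ℕ} {lam mu a b lam' b' : ℕ → ℕ}
    (hl : ∀ i < l, lam i = lam' i) (hb : ∀ i < l, b i = b' i) :
    tableauSum l lam mu a b = tableauSum l lam' mu a b' := by
  refine tableauSum_congr ?_ ?_
  · ext ⟨i, c⟩
    simp only [mem_natCells]
    grind
  · intro T
    constructor
    · rintro ⟨h1, h2, h3, h4⟩
      constructor <;> grind
    · rintro ⟨h1, h2, h3, h4⟩
      constructor <;> grind

lemma tableauSum_zero (lam mu a b : ℕ → ℕ) : tableauSum 0 lam mu a b = 1 := by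
  have h : {T | IsFlaggedTableau 0 lam mu a b T} = {fun _ => 0} := by
    ext T
    simp only [Set.mem_ofPred_eq, Set.mem_singleton_iff]
    refine ⟨fun h => ?_, ?_⟩
    · ext ⟨i, c⟩
      exact h.supp i c (by simp)
    · rintro rfl
      constructor <;> simp
  rw [tableauSum, h, finsum_mem_singleton]
  simp [natCells]

lemma tableauSum_succ_of_eq {l : ℕ} {lam mu a b : ℕ → ℕ} (h : lam l = mu l) :
    tableauSum (l + 1) lam mu a b = tableauSum l lam mu a b := by
  have key : ∀ i c, (i < l + 1 ∧ mu i < c ∧ c ≤ lam i) ↔ (i < l ∧ mu i < c ∧ c ≤ lam i) := by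
    intro i c
    rcases eq_or_ne i l with rfl | hi <;> omega
  refine tableauSum_congr ?_ ?_
  · ext ⟨i, c⟩
    simp only [mem_natCells, key]
  · intro T
    constructor
    · rintro ⟨h1, h2, h3, h4⟩
      constructor <;> grind
    · rintro ⟨h1, h2, h3, h4⟩
      constructor <;> grind

lemma tableauSum_succ_of_lt {l : ℕ} {lam mu a b : ℕ → ℕ} (h : mu l < lam l) (hab : b l ≤ a l) :
    tableauSum (l + 1) lam mu a b = 0 := by
  have h : {T | IsFlaggedTableau (l + 1) lam mu a b T} = ∅ := by
    ext T
    simp only [Set.mem_ofPred_eq, Set.mem_empty_iff_false, iff_false]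
    intro hT
    have := hT.flag l (lam l) (by omega) h le_rfl
    omega
  rw [tableauSum, h, finsum_mem_empty]

lemma IsFlaggedTableau.row_le {l : ℕ} {lam mu a b : ℕ → ℕ} {T : ℕ × ℕ → ℕ}
    (hT : IsFlaggedTableau l lam mu a b T) {i c d : ℕ} (hi : i < l) (hc : mu i < c)
    (hcd : c ≤ d) (hd : d ≤ lam i) : T (i, c) ≤ T (i, d) := by
  induction d, hcd using Nat.le_induction with
  | base => exact le_rfl
  | succ d hcd ih => exact (ih (by omega)).trans (hT.row i d hi (by omega) hd)

/-- Lowering the upper flag of one row selects the tableaux whose last entry in that row is not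
the maximal one. -/
lemma isFlaggedTableau_update_flag {l : ℕ} {lam mu a b : ℕ → ℕ} {k B : ℕ} (hk : k < l)
    (hb : b k = B + 1) (T : ℕ × ℕ → ℕ) :
    IsFlaggedTableau l lam mu a (Function.update b k B) T ↔
      IsFlaggedTableau l lam mu a b T ∧ (mu k < lam k → T (k, lam k) ≠ B) := by
  constructor
  · intro hT
    refine ⟨⟨hT.supp, hT.row, hT.col, fun i c hi hc hc' => ?_⟩, fun h => ?_⟩
    · have := hT.flag i c hi hc hc'
      rcases eq_or_ne i k with rfl | hik
      · rw [Function.update_self] at this; omega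
      · rwa [Function.update_of_ne hik] at this
    · have := hT.flag k (lam k) hk h le_rfl
      rw [Function.update_self] at this; omega
  · rintro ⟨hT, h⟩
    refine ⟨hT.supp, hT.row, hT.col, fun i c hi hc hc' => ?_⟩
    have h1 := hT.flag i c hi hc hc'
    rcases eq_or_ne i k with rfl | hik
    · rw [Function.update_self]
      have h2 := hT.row_le hi hc hc' le_rfl
      have h3 := hT.flag i (lam i) hi (by omega) le_rfl
      have h4 := h (by omega)
      omega
    · rwa [Function.update_of_ne hik]

lemma tableauSum_update_flag_of_eq {l : ℕ} {lam mu a b : ℕ → ℕ} {k B : ℕ} (hk : k < l)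
    (hb : b k = B + 1) (h : lam k = mu k) :
    tableauSum l lam mu a b = tableauSum l lam mu a (Function.update b k B) := by
  refine tableauSum_congr rfl fun T => ?_
  rw [isFlaggedTableau_update_flag hk hb]
  simp [h]

lemma tableauSum_update_flag_of_row_eq {l : ℕ} {lam mu a b : ℕ → ℕ} {k B : ℕ} (hk : k + 1 < l)
    (hb : b k = B + 1) (hb' : b (k + 1) = B + 1) (h : lam (k + 1) = lam k)
    (hmu : mu (k + 1) ≤ mu k) :
    tableauSum l lam mu a b = tableauSum l lam mu a (Function.update b k B) := by
  refine tableauSum_congr rfl fun T => ?_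
  rw [isFlaggedTableau_update_flag (by omega) hb]
  refine ⟨fun hT => ⟨hT, fun hlt => ?_⟩, fun hT => hT.1⟩
  have h1 := hT.col k (lam k) hk hlt le_rfl (by omega) h.ge
  have h2 := hT.flag (k + 1) (lam k) hk (by omega) h.ge
  omega

lemma natCells_eq_insert {l : ℕ} {lam mu : ℕ → ℕ} {k : ℕ} (hk : k < l) (h : mu k < lam k) :
    natCells l lam mu =
      insert (k, lam k) (natCells l (Function.update lam k (lam k - 1)) mu) := by
  ext ⟨i, c⟩
  simp only [Finset.mem_insert, mem_natCells, Prod.mk.injEq]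
  rcases eq_or_ne i k with rfl | hik
  · rw [Function.update_self]; omega
  · rw [Function.update_of_ne hik]; omega

lemma le_update_pred_iff {lam : ℕ → ℕ} {k : ℕ} (h : 0 < lam k) (i c : ℕ) :
    c ≤ Function.update lam k (lam k - 1) i ↔ c ≤ lam i ∧ ¬ (i = k ∧ c = lam k) := by
  rcases eq_or_ne i k with rfl | hik
  · rw [Function.update_self]; omega
  · rw [Function.update_of_ne hik]; tauto

lemma update_pair_of_not (T : ℕ × ℕ → ℕ) (x : ℕ) {i c k d : ℕ} (h : ¬ (i = k ∧ c = d)) :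
    Function.update T (k, d) x (i, c) = T (i, c) :=
  Function.update_of_ne (by simpa using h) _ _

/-- Deleting the last cell of a row. -/
lemma IsFlaggedTableau.deleteCell {l : ℕ} {lam mu a b : ℕ → ℕ} {k : ℕ} {T : ℕ × ℕ → ℕ}
    (hT : IsFlaggedTableau l lam mu a b T) (h : mu k < lam k) :
    IsFlaggedTableau l (Function.update lam k (lam k - 1)) mu a b
      (Function.update T (k, lam k) 0) := by
  have hle := le_update_pred_iff (Nat.zero_lt_of_lt h)
  constructor
  · intro i c hic
    rw [hle] at hic
    by_cases hk : i = k ∧ c = lam k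
    · rw [hk.1, hk.2, Function.update_self]
    · rw [update_pair_of_not T 0 hk]
      exact hT.supp i c (by tauto)
  · intro i c hi hc hc'
    rw [hle] at hc'
    rw [update_pair_of_not T 0 hc'.2, update_pair_of_not T 0 (by rintro ⟨rfl, rfl⟩; omega)]
    exact hT.row i c hi hc hc'.1
  · intro i c hi hc hc' hd hd'
    rw [hle] at hc' hd'
    rw [update_pair_of_not T 0 hc'.2, update_pair_of_not T 0 hd'.2]
    exact hT.col i c hi hc hc'.1 hd hd'.1
  · intro i c hi hc hc'
    rw [hle] at hc'
    rw [update_pair_of_not T 0 hc'.2]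
    exact hT.flag i c hi hc hc'.1

/-- Adding a cell with the largest possible entry at the end of a row. -/
lemma IsFlaggedTableau.addCell {l : ℕ} {lam mu a b : ℕ → ℕ} {k B : ℕ} {T : ℕ × ℕ → ℕ}
    (hT : IsFlaggedTableau l (Function.update lam k (lam k - 1)) mu a b T) (hk : k < l)
    (hb : b k = B + 1) (ha : a k ≤ B) (h : mu k < lam k)
    (hprev : ∀ i < k, b i ≤ B) (hnext : k + 1 < l → lam (k + 1) < lam k) :
    IsFlaggedTableau l lam mu a b (Function.update T (k, lam k) B) := by
  have hle := le_update_pred_iff (Nat.zero_lt_of_lt h)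
  constructor
  · intro i c hic
    rw [update_pair_of_not T B (by rintro ⟨rfl, rfl⟩; omega)]
    refine hT.supp i c ?_
    rw [hle]
    tauto
  · intro i c hi hc hc'
    have hc₁ : ¬ (i = k ∧ c = lam k) := by rintro ⟨rfl, rfl⟩; omega
    rw [update_pair_of_not T B hc₁]
    by_cases hk' : i = k ∧ c + 1 = lam k
    · have h1 := (hT.flag i c hi hc ((hle i c).2 ⟨by omega, hc₁⟩)).2
      rw [hk'.1, hb] at h1
      rw [hk'.1, hk'.2, Function.update_self]
      omega
    · rw [update_pair_of_not T B hk']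
      exact hT.row i c hi hc ((hle _ _).2 ⟨hc', hk'⟩)
  · intro i c hi hc hc' hd hd'
    have hc₁ : ¬ (i = k ∧ c = lam k) := by
      rintro ⟨rfl, rfl⟩
      have := hnext hi
      omega
    have hc₂ := (hle i c).2 ⟨hc', hc₁⟩
    rw [update_pair_of_not T B hc₁]
    by_cases hk' : i + 1 = k ∧ c = lam k
    · have h1 := (hT.flag i c (by omega) hc hc₂).2
      have h2 := hprev i (by omega)
      rw [hk'.1, ← hk'.2, Function.update_self]
      omega
    · rw [update_pair_of_not T B hk']
      exact hT.col i c hi hc hc₂ hd ((hle _ _).2 ⟨hd', hk'⟩)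
  · intro i c hi hc hc'
    by_cases hk' : i = k ∧ c = lam k
    · rw [hk'.1, hk'.2, Function.update_self]
      omega
    · rw [update_pair_of_not T B hk']
      exact hT.flag i c hi hc ((hle _ _).2 ⟨hc', hk'⟩)

lemma tableauSum_eq_add {l : ℕ} {lam mu a b : ℕ → ℕ} {k B : ℕ} (hk : k < l)
    (hb : b k = B + 1) (ha : a k ≤ B) (h : mu k < lam k)
    (hprev : ∀ i < k, b i ≤ B) (hnext : k + 1 < l → lam (k + 1) < lam k) :
    tableauSum l lam mu a b = tableauSum l lam mu a (Function.update b k B) +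
      X B * tableauSum l (Function.update lam k (lam k - 1)) mu a b := by
  have hsplit : {T | IsFlaggedTableau l lam mu a b T} =
      {T | IsFlaggedTableau l lam mu a (Function.update b k B) T} ∪
        {T | IsFlaggedTableau l lam mu a b T ∧ T (k, lam k) = B} := by
    ext T
    simp only [Set.mem_union, Set.mem_ofPred_eq, isFlaggedTableau_update_flag hk hb, h,
      true_imp_iff]
    tauto
  have hnot : (k, lam k) ∉ natCells l (Function.update lam k (lam k - 1)) mu := by
    rw [mem_natCells, Function.update_self]; omega
  rw [tableauSum, hsplit, finsum_mem_union]
  · refine congrArg₂ _ rfl ?_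
    rw [tableauSum, mul_finsum_mem]
    refine finsum_mem_eq_of_bijOn (fun T => Function.update T (k, lam k) 0) ⟨?_, ?_, ?_⟩ ?_
    · rintro T ⟨hT, -⟩
      exact hT.deleteCell h
    · rintro T ⟨-, hT⟩ T' ⟨-, hT'⟩ hTT'
      ext p
      rcases eq_or_ne p (k, lam k) with rfl | hp
      · rw [hT, hT']
      · have := congrFun hTT' p
        simpa only [Function.update_of_ne hp] using this
    · rintro T hT
      refine ⟨Function.update T (k, lam k) B,
        ⟨hT.addCell hk hb ha h hprev hnext, Function.update_self ..⟩, ?_⟩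
      have := hT.supp k (lam k) (by rw [Function.update_self]; omega)
      simp only [Function.update_idem]
      rw [← this, Function.update_eq_self]
    · rintro T ⟨-, hT⟩
      rw [natCells_eq_insert hk h, Finset.prod_insert hnot, hT]
      congr 1
      refine Finset.prod_congr rfl fun p hp => ?_
      rw [Function.update_of_ne]
      rintro rfl
      exact hnot hp
  · rw [Set.disjoint_left]
    rintro T hT ⟨-, hT'⟩
    exact ((isFlaggedTableau_update_flag hk hb T).1 hT).2 h hT'
  · exact finite_isFlaggedTableau _ _ _ _ _
  · exact (finite_isFlaggedTableau l lam mu a b).subset fun T hT => hT.1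

/-- The complete homogeneous polynomial in the variables indexed by `[a, b)`, as a sum over
tableaux with one row. -/
noncomputable def rowSum (m : ℤ) (a b : ℕ) : MvPolynomial ℕ ℚ :=
  if 0 ≤ m then tableauSum 1 (fun _ => m.toNat) (fun _ => 0) (fun _ => a) (fun _ => b) else 0

lemma rowSum_of_neg {m : ℤ} (h : m < 0) (a b : ℕ) : rowSum m a b = 0 := if_neg h.not_ge

lemma rowSum_zero (a b : ℕ) : rowSum 0 a b = 1 := by
  rw [rowSum, if_pos le_rfl, tableauSum_succ_of_eq (by simp), tableauSum_zero]

lemma rowSum_of_pos {m : ℤ} (h : 0 < m) {a b : ℕ} (hab : b ≤ a) : rowSum m a b = 0 := by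
  rw [rowSum, if_pos h.le]
  exact tableauSum_succ_of_lt (by omega) hab

lemma rowSum_succ (m : ℤ) {a B : ℕ} (h : a ≤ B) :
    rowSum m a (B + 1) = rowSum m a B + X B * rowSum (m - 1) a (B + 1) := by
  rcases lt_trichotomy m 0 with hm | rfl | hm
  · simp [rowSum_of_neg hm, rowSum_of_neg (show m - 1 < 0 by omega)]
  · simp [rowSum_zero, rowSum_of_neg]
  · rw [rowSum, rowSum, rowSum, if_pos hm.le, if_pos hm.le, if_pos (by omega),
      tableauSum_eq_add (k := 0) (B := B) one_pos rfl h (by omega) (by simp) (by simp)]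
    refine congrArg₂ _ (tableauSum_congr_of_eqOn (fun _ _ => rfl) fun i hi => ?_)
      (congrArg _ (tableauSum_congr_of_eqOn (fun i hi => ?_) fun _ _ => rfl))
    · rw [Nat.lt_one_iff.1 hi, Function.update_self]
    · rw [Nat.lt_one_iff.1 hi, Function.update_self]; omega

lemma Matrix.det_eq_zero_of_forall_le_of_forall_ge {R : Type*} [CommRing R] {n : ℕ}
    (M : Matrix (Fin n) (Fin n) R) (k : Fin n) (h : ∀ i j, k ≤ i → j ≤ k → M i j = 0) :
    M.det = 0 := by
  rw [Matrix.det_apply]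
  refine Finset.sum_eq_zero fun σ _ => ?_
  obtain ⟨j, hj, hσ⟩ : ∃ j, j ≤ k ∧ k ≤ σ j := by
    by_contra! hcon
    have := Finset.card_le_card_of_injOn (s := Finset.Iic k) (t := Finset.Iio k) σ
      (fun j hj => by simpa using hcon j (by simpa using hj)) σ.injective.injOn
    simp at this
  have hprod : ∏ i, M (σ i) i = 0 := Finset.prod_eq_zero (Finset.mem_univ j) (h _ _ hσ hj)
  exact (congrArg _ hprod).trans (smul_zero _)

/-- The flagged Jacobi–Trudi matrix with half-open flags. -/
noncomputable def flaggedMatrix (l : ℕ) (lam mu a b : ℕ → ℕ) :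
    Matrix (Fin l) (Fin l) (MvPolynomial ℕ ℚ) :=
  Matrix.of fun i j => rowSum ((lam i : ℤ) - mu j - (i : ℕ) + (j : ℕ)) (a j) (b i)

lemma det_flaggedMatrix_succ {l : ℕ} {lam mu a b : ℕ → ℕ}
    (hlam : ∀ i j, i ≤ j → j < l + 1 → lam j ≤ lam i) (hsub : ∀ i < l + 1, mu i ≤ lam i)
    (hb : ∀ i j, i ≤ j → j < l + 1 → b i ≤ b j) (hab : b l ≤ a l) :
    (flaggedMatrix (l + 1) lam mu a b).det =
      if lam l = mu l then (flaggedMatrix l lam mu a b).det else 0 := by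
  have hl := hsub l (by omega)
  rw [Matrix.det_succ_column _ (Fin.last l), Fin.sum_univ_castSucc, Finset.sum_eq_zero, zero_add]
  · have hsubm : (flaggedMatrix (l + 1) lam mu a b).submatrix (Fin.last l).succAbove
        (Fin.last l).succAbove = flaggedMatrix l lam mu a b := by
      ext1 i j
      simp [flaggedMatrix]
    have hpow : (-1 : MvPolynomial ℕ ℚ) ^ (l + l) = 1 := Even.neg_one_pow ⟨l, rfl⟩
    rw [hsubm]
    simp only [flaggedMatrix, Matrix.of_apply, Fin.val_last, hpow, one_mul]
    split_ifs with h
    · rw [h, show (mu l : ℤ) - mu l - l + l = 0 by ring, rowSum_zero, one_mul]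
    · rw [rowSum_of_pos (by omega) hab, zero_mul]
  · intro i _
    have h1 := hlam i l i.2.le (by omega)
    have h2 := hb i l i.2.le (by omega)
    have h3 := i.2
    simp only [flaggedMatrix, Matrix.of_apply, Fin.val_last, Fin.val_castSucc]
    rw [rowSum_of_pos (by omega) (by omega), mul_zero, zero_mul]

/-- The row of the flagged Jacobi–Trudi matrix obtained by shortening row `k` of the diagram. -/
noncomputable def shortenedRow (l : ℕ) (lam mu a b : ℕ → ℕ) (k : ℕ) :
    Fin l → MvPolynomial ℕ ℚ :=
  fun j => rowSum ((lam k : ℤ) - 1 - mu j - k + (j : ℕ)) (a j) (b k)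

lemma det_flaggedMatrix_eq_add {l : ℕ} {lam mu a b : ℕ → ℕ} (k : Fin l) {B : ℕ}
    (hb : b k = B + 1) (ha : ∀ j < l, a j ≤ B) :
    (flaggedMatrix l lam mu a b).det =
      (flaggedMatrix l lam mu a (Function.update b k B)).det +
      X B * ((flaggedMatrix l lam mu a b).updateRow k (shortenedRow l lam mu a b k)).det := by
  have h1 : flaggedMatrix l lam mu a (Function.update b k B) =
      (flaggedMatrix l lam mu a b).updateRow k
        fun j => rowSum ((lam k : ℤ) - mu j - (k : ℕ) + (j : ℕ)) (a j) B := by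
    ext1 i j
    rcases eq_or_ne i k with rfl | hik
    · simp only [Matrix.updateRow_self, flaggedMatrix, Matrix.of_apply, Function.update_self]
    · rw [Matrix.updateRow_ne hik]
      simp only [flaggedMatrix, Matrix.of_apply]
      rw [Function.update_of_ne (Fin.val_ne_of_ne hik)]
  rw [h1, ← Matrix.det_updateRow_smul, ← Matrix.det_updateRow_add]
  congr 1
  ext1 i j
  rcases eq_or_ne i k with rfl | hik
  · rw [Matrix.updateRow_self]
    simp only [flaggedMatrix, shortenedRow, Matrix.of_apply, Pi.add_apply, Pi.smul_apply,
      smul_eq_mul, hb]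
    rw [rowSum_succ _ (ha j j.2)]
    congr 3
    ring
  · rw [Matrix.updateRow_ne hik]

lemma updateRow_shortenedRow {l : ℕ} {lam mu a b : ℕ → ℕ} (k : Fin l) (h : 0 < lam k) :
    (flaggedMatrix l lam mu a b).updateRow k (shortenedRow l lam mu a b k) =
      flaggedMatrix l (Function.update lam k (lam k - 1)) mu a b := by
  ext1 i j
  rcases eq_or_ne i k with rfl | hik
  · rw [Matrix.updateRow_self]
    simp only [flaggedMatrix, shortenedRow, Matrix.of_apply, Function.update_self]
    push_cast [Nat.cast_sub (show 1 ≤ lam i from h)]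
    rfl
  · rw [Matrix.updateRow_ne hik]
    simp only [flaggedMatrix, Matrix.of_apply]
    rw [Function.update_of_ne (Fin.val_ne_of_ne hik)]

lemma det_updateRow_shortenedRow_of_eq {l : ℕ} {lam mu a b : ℕ → ℕ} (k : Fin l)
    (hlam : ∀ i j, i ≤ j → j < l → lam j ≤ lam i) (hmu : ∀ i j, i ≤ j → j < l → mu j ≤ mu i)
    (h : lam k = mu k) :
    ((flaggedMatrix l lam mu a b).updateRow k (shortenedRow l lam mu a b k)).det = 0 := by
  refine Matrix.det_eq_zero_of_forall_le_of_forall_ge _ k fun i j hi hj => ?_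
  have h1 := hmu j k hj k.2
  rcases eq_or_ne i k with rfl | hik
  · rw [Matrix.updateRow_self]
    exact rowSum_of_neg (by omega) _ _
  · rw [Matrix.updateRow_ne hik]
    have h2 := hlam k i hi i.2
    exact rowSum_of_neg (by omega) _ _

lemma det_updateRow_shortenedRow_of_row_eq {l : ℕ} {lam mu a b : ℕ → ℕ} (k : Fin l)
    (hk : (k : ℕ) + 1 < l) (h : lam (k + 1) = lam k) (hb : b (k + 1) = b k) :
    ((flaggedMatrix l lam mu a b).updateRow k (shortenedRow l lam mu a b k)).det = 0 := by
  have hne : (⟨k + 1, hk⟩ : Fin l) ≠ k := by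
    intro h
    simpa using congrArg Fin.val h
  refine Matrix.det_zero_of_row_eq hne.symm ?_
  rw [Matrix.updateRow_self, Matrix.updateRow_ne hne]
  ext1 j
  simp only [flaggedMatrix, shortenedRow, Matrix.of_apply, h, hb]
  congr 1
  push_cast
  ring

theorem tableauSum_eq_det (l : ℕ) (lam mu a b : ℕ → ℕ)
    (hlam : ∀ i j, i ≤ j → j < l → lam j ≤ lam i) (hmu : ∀ i j, i ≤ j → j < l → mu j ≤ mu i)
    (hsub : ∀ i < l, mu i ≤ lam i)
    (ha : ∀ i j, i ≤ j → j < l → a i ≤ a j) (hb : ∀ i j, i ≤ j → j < l → b i ≤ b j) :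
    tableauSum l lam mu a b = (flaggedMatrix l lam mu a b).det := by
  induction l generalizing lam b with
  | zero => rw [tableauSum_zero, Matrix.det_isEmpty]
  | succ l ihl =>
    induction hn : ∑ i ∈ Finset.range (l + 1), (lam i + b i) using Nat.strong_induction_on
      generalizing lam b with
    | _ n ih =>
      rcases le_or_gt (b l) (a l) with hab | hab
      · rw [det_flaggedMatrix_succ hlam hsub hb hab]
        split_ifs with h
        · rw [tableauSum_succ_of_eq h]
          exact ihl lam b (fun i j hij hj => hlam i j hij (by omega))
            (fun i j hij hj => hmu i j hij (by omega)) (fun i hi => hsub i (by omega))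
            (fun i j hij hj => ha i j hij (by omega)) (fun i j hij hj => hb i j hij (by omega))
        · exact tableauSum_succ_of_lt (lt_of_le_of_ne (hsub l (by omega)) (Ne.symm h)) hab
      · obtain ⟨B, hB⟩ : ∃ B, b l = B + 1 := ⟨b l - 1, by omega⟩
        have hex : ∃ i, b i = b l := ⟨l, rfl⟩
        classical
        obtain ⟨k, hkl, hk, hlt⟩ : ∃ k ≤ l, b k = b l ∧ ∀ i < k, b i ≠ b l :=
          ⟨Nat.find hex, Nat.find_min' hex rfl, Nat.find_spec hex, fun i hi => Nat.find_min hex hi⟩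
        rw [hB] at hk
        have hprev : ∀ i < k, b i ≤ B := fun i hi => by
          have h1 := hb i l (by omega) (by omega)
          have h2 := hlt i hi
          omega
        have hk' : k < l + 1 := by omega
        have hflag : tableauSum (l + 1) lam mu a (Function.update b k B) =
            (flaggedMatrix (l + 1) lam mu a (Function.update b k B)).det := by
          refine ih _ ?_ lam (Function.update b k B) hlam hsub ?_ rfl
          · rw [← hn]
            refine Finset.sum_lt_sum (fun i _ => ?_) ⟨k, Finset.mem_range.2 hk', ?_⟩
            · rcases eq_or_ne i k with rfl | hik
              · rw [Function.update_self]; omega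
              · rw [Function.update_of_ne hik]
            · rw [Function.update_self]; omega
          · intro i j hij hj
            have h1 := hb i j hij hj
            have h2 := hprev i
            grind
        have ha' : ∀ j < l + 1, a j ≤ B := fun j hj => by
          have := ha j l (by omega) (by omega)
          omega
        rw [det_flaggedMatrix_eq_add ⟨k, hk'⟩ hk ha', ← hflag]
        rcases (hsub k hk').eq_or_lt with heq | hmulam
        · rw [det_updateRow_shortenedRow_of_eq ⟨k, hk'⟩ hlam hmu heq.symm, mul_zero, add_zero]
          exact tableauSum_update_flag_of_eq hk' hk heq.symm
        by_cases hrow : k + 1 < l + 1 ∧ lam (k + 1) = lam k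
        · have h1 : b (k + 1) = B + 1 := by
            have h1 := hb k (k + 1) (by omega) hrow.1
            have h2 := hb (k + 1) l (by omega) (by omega)
            omega
          rw [det_updateRow_shortenedRow_of_row_eq ⟨k, hk'⟩ hrow.1 hrow.2 (h1.trans hk.symm),
            mul_zero, add_zero]
          exact tableauSum_update_flag_of_row_eq hrow.1 hk h1 hrow.2
            (hmu k (k + 1) (by omega) hrow.1)
        · have hnext : k + 1 < l + 1 → lam (k + 1) < lam k := fun h => by
            have := hlam k (k + 1) (by omega) h
            omega
          rw [updateRow_shortenedRow ⟨k, hk'⟩ (by simp only; omega),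
            tableauSum_eq_add hk' hk (ha' k hk') hmulam hprev hnext]
          congr 2
          refine ih _ ?_ _ b ?_ ?_ hb rfl
          · rw [← hn]
            refine Finset.sum_lt_sum (fun i _ => ?_) ⟨k, Finset.mem_range.2 hk', ?_⟩
            · rcases eq_or_ne i k with rfl | hik
              · rw [Function.update_self]; omega
              · rw [Function.update_of_ne hik]
            · rw [Function.update_self]; omega
          · intro i j hij hj
            have h1 := hlam i j hij hj
            rcases eq_or_ne i k with rfl | hik
            · rcases eq_or_ne j i with rfl | hji
              · rfl
              · have h2 := hlam (i + 1) j (by omega) hj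
                have h3 := hnext (by omega)
                rw [Function.update_self, Function.update_of_ne hji]
                omega
            · grind
          · intro i hi
            have := hsub i hi
            grind

lemma Finset.sum_ite_zero_eq_finsum_mem {α M : Type*} [Fintype α] [AddCommMonoid M]
    (P : α → Prop) [DecidablePred P] (f : α → M) :
    ∑ x, (if P x then f x else 0) = ∑ᶠ x ∈ {x | P x}, f x := by
  rw [finsum_mem_def, finsum_eq_sum_of_fintype]
  refine Finset.sum_congr rfl fun x _ => ?_
  by_cases h : P x <;> simp [h]

lemma hFlag_eq_tableauSum (m a b : ℕ) :
    hFlag m a b =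
      tableauSum 1 (fun _ => m) (fun _ => 0) (fun _ => a) (fun _ => b + 1) := by
  classical
  have hcells : natCells 1 (fun _ => m) (fun _ => 0) =
      Finset.univ.image fun i : Fin m => (0, (i : ℕ) + 1) := by
    ext ⟨i, c⟩
    simp only [mem_natCells, Finset.mem_image, Finset.mem_univ, true_and, Prod.mk.injEq]
    constructor
    · intro h
      exact ⟨⟨c - 1, by omega⟩, by omega, by simp only; omega⟩
    · rintro ⟨j, h1, h2⟩
      omega
  rw [hFlag, Finset.sum_ite_zero_eq_finsum_mem, tableauSum]
  refine finsum_mem_eq_of_bijOn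
    (fun f p => if h : p.1 = 0 ∧ 0 < p.2 ∧ p.2 ≤ m then (f ⟨p.2 - 1, by omega⟩ : ℕ) else 0)
    ⟨?_, ?_, ?_⟩ ?_
  · rintro f ⟨hf, hfa⟩
    constructor
    · intro i c h
      exact dif_neg (by omega)
    · intro i c hi hc hc'
      beta_reduce
      rw [dif_pos (by omega), dif_pos (by omega)]
      exact hf (Fin.mk_le_mk.2 (by simp only; omega))
    · intro i c hi
      omega
    · intro i c hi hc hc'
      beta_reduce
      rw [dif_pos (by omega)]
      exact ⟨hfa _, (f _).2⟩
  · rintro f - g - hfg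
    ext i
    have := congrFun hfg (0, (i : ℕ) + 1)
    simpa [Nat.succ_le_iff] using this
  · rintro T hT
    refine ⟨fun i => ⟨T (0, (i : ℕ) + 1), ?_⟩, ⟨?_, ?_⟩, ?_⟩
    · exact (hT.flag 0 (i + 1) one_pos (by omega) (by omega)).2
    · intro i j hij
      exact hT.row_le one_pos (by simp) (Nat.succ_le_succ hij) (Nat.succ_le_of_lt j.2)
    · intro i
      exact (hT.flag 0 (i + 1) one_pos (by omega) (by omega)).1
    · ext ⟨i, c⟩
      by_cases h : i = 0 ∧ 0 < c ∧ c ≤ m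
      · simp only [dif_pos h]
        rw [h.1, Nat.sub_add_cancel h.2.1]
      · simp only [dif_neg h]
        exact (hT.supp i c (by omega)).symm
  · intro f _
    rw [hcells, Finset.prod_image (fun i _ j _ hij => by simpa [Fin.ext_iff] using hij)]
    refine Finset.prod_congr rfl fun i _ => ?_
    simp

lemma hFlagZ_eq_rowSum (m : ℤ) (a b : ℕ) : hFlagZ m a b = rowSum m a (b + 1) := by
  rw [hFlagZ, rowSum, hFlag_eq_tableauSum]

/-- Extension of a function on `Fin l` to `ℕ` by zero. -/
def extendFin {l : ℕ} (f : Fin l → ℕ) (i : ℕ) : ℕ := if h : i < l then f ⟨i, h⟩ else 0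

lemma extendFin_of_lt {l : ℕ} (f : Fin l → ℕ) {i : ℕ} (h : i < l) :
    extendFin f i = f ⟨i, h⟩ := dif_pos h

lemma extendFin_val {l : ℕ} (f : Fin l → ℕ) (i : Fin l) : extendFin f i = f i :=
  extendFin_of_lt f i.2

lemma mem_skewCells {l : ℕ} {lam mu : Fin l → ℕ} {c : Fin l × ℕ} :
    c ∈ skewCells lam mu ↔ mu c.1 < c.2 ∧ c.2 ≤ lam c.1 := by
  simp only [skewCells, Finset.mem_filter, Finset.mem_product, Finset.mem_univ, true_and,
    Finset.mem_range, and_iff_right_iff_imp]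
  intro h
  have := Finset.single_le_sum (f := lam) (fun _ _ => Nat.zero_le _) (Finset.mem_univ c.1)
  omega

lemma flaggedSchur_eq_tableauSum {l : ℕ} (lam mu a b : Fin l → ℕ) :
    flaggedSchur lam mu a b =
      tableauSum l (extendFin lam) (extendFin mu) (extendFin a) (fun i => extendFin b i + 1) := by
  classical
  have hmem : ∀ {i c} (hi : i < l), extendFin mu i < c → c ≤ extendFin lam i →
      ((⟨i, hi⟩, c) : Fin l × ℕ) ∈ skewCells lam mu := by
    intro i c hi hc hc'
    rw [extendFin_of_lt _ hi] at hc hc'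
    exact mem_skewCells.2 ⟨hc, hc'⟩
  have hmem' : ∀ {i : Fin l} {c}, (i, c) ∈ skewCells lam mu →
      extendFin mu i < c ∧ c ≤ extendFin lam i := by
    intro i c h
    rw [extendFin_val, extendFin_val]
    exact mem_skewCells.1 h
  have hcells : natCells l (extendFin lam) (extendFin mu) =
      Finset.univ.image fun c : {c // c ∈ skewCells lam mu} => ((c.1.1 : ℕ), c.1.2) := by
    ext ⟨i, c⟩
    simp only [mem_natCells, Finset.mem_image, Finset.mem_univ, true_and, Prod.mk.injEq]
    constructor
    · rintro ⟨hi, hc, hc'⟩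
      exact ⟨⟨_, hmem hi hc hc'⟩, rfl, rfl⟩
    · rintro ⟨⟨⟨j, d⟩, h⟩, rfl, rfl⟩
      exact ⟨j.2, hmem' h⟩
  rw [flaggedSchur, Finset.sum_ite_zero_eq_finsum_mem, tableauSum]
  refine finsum_mem_eq_of_bijOn
    (fun T p => if h : p.1 < l ∧ extendFin mu p.1 < p.2 ∧ p.2 ≤ extendFin lam p.1 then
      (T ⟨(⟨p.1, h.1⟩, p.2), hmem h.1 h.2.1 h.2.2⟩ : ℕ) else 0) ⟨?_, ?_, ?_⟩ ?_
  · rintro T ⟨hrow, hcol, hflag⟩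
    constructor
    · intro i c h
      exact dif_neg h
    · intro i c hi hc hc'
      beta_reduce
      rw [dif_pos ⟨hi, hc, Nat.le_of_succ_le hc'⟩, dif_pos ⟨hi, Nat.lt_succ_of_lt hc, hc'⟩]
      exact hrow _ _ rfl rfl
    · intro i c hi hc hc' hd hd'
      beta_reduce
      rw [dif_pos ⟨by omega, hc, hc'⟩, dif_pos ⟨hi, hd, hd'⟩]
      exact hcol _ _ rfl rfl
    · intro i c hi hc hc'
      beta_reduce
      rw [dif_pos ⟨hi, hc, hc'⟩, Nat.lt_succ_iff]
      simpa only [extendFin_of_lt a hi, extendFin_of_lt b hi] using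
        hflag ⟨(⟨i, hi⟩, c), hmem hi hc hc'⟩
  · rintro T - T' - hTT'
    ext ⟨⟨i, c⟩, h⟩
    have := congrFun hTT' ((i : ℕ), c)
    simpa only [dif_pos (And.intro i.2 (hmem' h))] using this
  · rintro T hT
    refine ⟨fun c => ⟨T ((c.1.1 : ℕ), c.1.2), ?_⟩, ⟨?_, ?_, ?_⟩, ?_⟩
    · obtain ⟨⟨i, c⟩, h⟩ := c
      have h1 := (hT.flag i c i.2 (hmem' h).1 (hmem' h).2).2
      have h2 := Finset.single_le_sum (f := b) (fun _ _ => Nat.zero_le _) (Finset.mem_univ i)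
      rw [extendFin_val] at h1
      exact h1.trans_le (Nat.succ_le_succ h2)
    · rintro ⟨⟨i, c⟩, h⟩ ⟨⟨j, d⟩, h'⟩ hij hcd
      obtain rfl : j = i := hij
      obtain rfl : d = c + 1 := hcd
      exact hT.row j c j.2 (hmem' h).1 (hmem' h').2
    · rintro ⟨⟨i, c⟩, h⟩ ⟨⟨j, d⟩, h'⟩ hij hcd
      obtain rfl : d = c := hcd
      replace hij : (j : ℕ) = i + 1 := hij
      have h3 := hmem' h'
      have h4 := j.2
      rw [hij] at h3 h4
      simp only [hij]
      exact hT.col i d h4 (hmem' h).1 (hmem' h).2 h3.1 h3.2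
    · rintro ⟨⟨i, c⟩, h⟩
      have h1 := hT.flag i c i.2 (hmem' h).1 (hmem' h).2
      rw [extendFin_val, extendFin_val, Nat.lt_succ_iff] at h1
      exact h1
    · ext ⟨i, c⟩
      by_cases h : i < l ∧ extendFin mu i < c ∧ c ≤ extendFin lam i
      · simp only [dif_pos h]
      · simp only [dif_neg h]
        exact (hT.supp i c h).symm
  · intro T _
    rw [hcells, Finset.prod_image]
    · refine Finset.prod_congr rfl ?_
      rintro ⟨⟨i, c⟩, h⟩ -
      simp only [dif_pos (And.intro i.2 (hmem' h))]
    · rintro ⟨⟨i, c⟩, h⟩ - ⟨⟨j, d⟩, h'⟩ - hij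
      simpa [Fin.ext_iff] using hij

theorem flagged_jacobi_trudi {l : ℕ} (lam mu a b : Fin l → ℕ)
    (hlam : Antitone lam) (hmu : Antitone mu) (hsub : ∀ i, mu i ≤ lam i)
    (ha : Monotone a) (hb : Monotone b) :
    flaggedSchur lam mu a b
      = Matrix.det (Matrix.of fun i j : Fin l =>
          hFlagZ ((lam i : ℤ) - (mu j : ℤ) - (i : ℕ) + (j : ℕ)) (a j) (b i)) := by
  rw [flaggedSchur_eq_tableauSum, tableauSum_eq_det]
  · congr 1
    ext1 i j
    simp only [flaggedMatrix, Matrix.of_apply, extendFin_val, hFlagZ_eq_rowSum]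
  · intro i j hij hj
    rw [extendFin_of_lt _ hj, extendFin_of_lt _ (hij.trans_lt hj)]
    exact hlam hij
  · intro i j hij hj
    rw [extendFin_of_lt _ hj, extendFin_of_lt _ (hij.trans_lt hj)]
    exact hmu hij
  · intro i hi
    rw [extendFin_of_lt _ hi, extendFin_of_lt _ hi]
    exact hsub _
  · intro i j hij hj
    rw [extendFin_of_lt _ hj, extendFin_of_lt _ (hij.trans_lt hj)]
    exact ha hij
  · intro i j hij hj
    rw [extendFin_of_lt _ hj, extendFin_of_lt _ (hij.trans_lt hj)]
    exact Nat.succ_le_succ (hb hij)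
end

section
/- If the flagged Gelfand–Tsetlin polytope P(lambda/mu, nu, a, b) is nonempty, then its lexicographically smallest point (reading rows left to right, top to bottom) is a vertex with integer coordinates; in particular every nonempty flagged Gelfand–Tsetlin polytope contains a lattice point. -/
/-!
STATEMENT 18: If the flagged Gelfand–Tsetlin polytope
`P(lam/mu, nu, a, b)` is nonempty then its lexicographically smallest point
(reading rows left to right, top to bottom — the top row of the pattern being
row `n`) is a vertex (extreme point) with integer coordinates; in particular
every nonempty flagged Gelfand–Tsetlin polytope contains a lattice point.
-/

open scoped BigOperators

/-- The flagged Gelfand–Tsetlin polytope: real arrays `(x_{i,j})` with top row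
`lam`, bottom row `mu`, interlacing inequalities, flag conditions and row-sum
conditions given by `nu`.  (Rows of index `> n` are pinned to `lam` so that
points are determined by their entries with `0 ≤ i ≤ n`.) -/
def flaggedGTPolytope {m : ℕ} (n : ℕ) (lam mu : Fin m → ℕ) (nu : ℕ → ℕ)
    (a b : Fin m → ℕ) : Set (ℕ → Fin m → ℝ) :=
  {X | (∀ j, X n j = lam j) ∧
    (∀ j, X 0 j = mu j) ∧
    (∀ i, n < i → ∀ j, X i j = lam j) ∧
    (∀ i < n, ∀ j : Fin m, X i j ≤ X (i + 1) j) ∧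
    (∀ i < n, ∀ j j' : Fin m, (j' : ℕ) = (j : ℕ) + 1 → X (i + 1) j' ≤ X i j) ∧
    (∀ i, 1 ≤ i → i ≤ n → ∀ j : Fin m,
      i ∉ Finset.Icc (a j) (b j) → X i j = X (i - 1) j) ∧
    (∀ i, 1 ≤ i → i ≤ n → (∑ j : Fin m, (X i j - X (i - 1) j)) = (nu i : ℝ))}

/-- `p` is lexicographically smallest in `S`, reading the rows of the pattern
from the top (row `n`) downwards, each row left to right. -/
def IsLexSmallest {m : ℕ} (n : ℕ) (S : Set (ℕ → Fin m → ℝ))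
    (p : ℕ → Fin m → ℝ) : Prop :=
  p ∈ S ∧ ∀ q ∈ S, q ≠ p →
    ∃ (t : ℕ) (j : Fin m), t ≤ n ∧ p (n - t) j < q (n - t) j ∧
      ∀ (t' : ℕ) (j' : Fin m), t' ≤ n →
        (t' < t ∨ (t' = t ∧ j' < j)) → p (n - t') j' = q (n - t') j'

/-- `r` is the image of an integer. -/
def IsIntegerReal (r : ℝ) : Prop := ∃ z : ℤ, r = (z : ℝ)

lemma IsIntegerReal.add {r s : ℝ} (hr : IsIntegerReal r) (hs : IsIntegerReal s) :
    IsIntegerReal (r + s) := by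
  obtain ⟨a, rfl⟩ := hr
  obtain ⟨b, rfl⟩ := hs
  exact ⟨a + b, by push_cast; ring⟩

lemma IsIntegerReal.sub {r s : ℝ} (hr : IsIntegerReal r) (hs : IsIntegerReal s) :
    IsIntegerReal (r - s) := by
  obtain ⟨a, rfl⟩ := hr
  obtain ⟨b, rfl⟩ := hs
  exact ⟨a - b, by push_cast; ring⟩

lemma IsIntegerReal.natCast (k : ℕ) : IsIntegerReal (k : ℝ) := ⟨k, by simp⟩

lemma IsIntegerReal.sum {ι : Type*} (s : Finset ι) (f : ι → ℝ) (h : ∀ i ∈ s, IsIntegerReal (f i)) :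
    IsIntegerReal (∑ i ∈ s, f i) := by
  classical
  induction s using Finset.induction_on with
  | empty => exact ⟨0, by simp⟩
  | insert a s ha ih =>
    rw [Finset.sum_insert ha]
    exact (h a (by simp)).add (ih fun i hi => h i (by simp [hi]))

/-! ### Lexicographic minima of compact sets -/

lemma IsCompact.exists_lex_min {X : Type*} [TopologicalSpace X] {K : Set X}
    (hK : IsCompact K) (hne : K.Nonempty) (f : ℕ → X → ℝ) (hf : ∀ k, Continuous (f k)) (N : ℕ) :
    ∃ p ∈ K, ∀ q ∈ K, (∀ k < N, f k p = f k q) ∨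
      ∃ k < N, f k p < f k q ∧ ∀ l < k, f l p = f l q := by
  induction N with
  | zero =>
    obtain ⟨p, hp⟩ := hne
    exact ⟨p, hp, fun q _ => Or.inl (by simp)⟩
  | succ N ih =>
    obtain ⟨p, hp, hmin⟩ := ih
    have hcl : IsClosed {q : X | ∀ k < N, f k p = f k q} := by
      simp only [Set.ofPred_forall]
      exact isClosed_iInter fun k => isClosed_iInter fun _ =>
        isClosed_eq continuous_const (hf k)
    obtain ⟨p', ⟨hp', hpp'⟩, hmin'⟩ := (hK.inter_right hcl).exists_isMinOn
      ⟨p, hp, fun k _ => rfl⟩ (hf N).continuousOn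
    refine ⟨p', hp', fun q hq => ?_⟩
    rcases hmin q hq with h | ⟨k, hk, hlt, heq⟩
    · have hle : f N p' ≤ f N q := hmin' ⟨hq, h⟩
      rcases hle.eq_or_lt with h' | h'
      · left
        intro k hk
        rcases Nat.lt_succ_iff_lt_or_eq.mp hk with hk | rfl
        · rw [← hpp' k hk, h k hk]
        · exact h'
      · exact Or.inr ⟨N, Nat.lt_succ_self N, h', fun l hl => by rw [← hpp' l hl, h l hl]⟩
    · refine Or.inr ⟨k, hk.trans (Nat.lt_succ_self N), ?_, fun l hl => ?_⟩
      · rwa [← hpp' k hk]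
      · rw [← hpp' l (hl.trans hk), heq l hl]

/-! ### Closed sets of the exchange relation between consecutive rows -/

/-- Two consecutive rows have supports `N` and `N'`; an entry `j` of `N'` may be linked to the
entry `c j` of `N`, either so that it dominates it (`V`) or so that it is dominated by it (`D`).
A set closed under exchange in the upper row induces such a set in the lower row. -/
lemma exists_closed_of_closed {α : Type*} [Fintype α] [DecidableEq α] (N N' : Finset α)
    (V D : α → Prop) (c : α → α) (hVD : ∀ j ∈ N', V j → ¬ D j)
    (hinj : ∀ j ∈ N', ∀ j' ∈ N', V j ∨ D j → V j' ∨ D j' → c j = c j' → j = j')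
    (T T' : (α → ℝ) → Prop) (h0 : T 0) (hadd : ∀ u v, T u → T v → T (u + v))
    (hext : ∀ u r : α → ℝ, T u → (∀ j, j ∉ N' → r j = 0) → ∑ j, r j = 0 →
      (∀ j ∈ N', V j → u (c j) ≤ r j) → (∀ j ∈ N', D j → r j ≤ u (c j)) → T' r)
    (A : Finset α) (hA : A ⊆ N')
    (hcl : ∀ j ∈ A, ∀ j' ∈ N', j' ∉ A → ¬ T' (Pi.single j 1 - Pi.single j' 1)) :
    ((∀ j ∈ N', j ∉ A → V j) ∧ ∀ k ∈ N \ (N' \ A).image c, ∀ l ∈ N,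
        l ∉ N \ (N' \ A).image c → ¬ T (Pi.single k 1 - Pi.single l 1)) ∨
    ((∀ j ∈ A, D j) ∧ ∀ k ∈ A.image c, ∀ l ∈ N,
        l ∉ A.image c → ¬ T (Pi.single k 1 - Pi.single l 1)) := by
  have hext' : ∀ j ∈ A, ∀ j' ∈ N', j' ∉ A → ∀ u, T u →
      (∀ p ∈ N', V p → u (c p) ≤ (Pi.single j 1 - Pi.single j' 1 : α → ℝ) p) →
      (∀ p ∈ N', D p → (Pi.single j 1 - Pi.single j' 1 : α → ℝ) p ≤ u (c p)) → False := by
    intro j hj j' hj' hj'A u hu hV hD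
    refine hcl j hj j' hj' hj'A (hext u _ hu ?_ (by simp) hV hD)
    intro p hp
    have h1 : p ≠ j := fun h => hp (h ▸ hA hj)
    have h2 : p ≠ j' := fun h => hp (h ▸ hj')
    simp [h1, h2]
  have hnc : ∀ j ∈ A, ∀ j' ∈ N', j' ∉ A → V j ∨ D j → V j' ∨ D j' →
      ¬ T (Pi.single (c j) 1 - Pi.single (c j') 1) := by
    intro j hj j' hj' hj'A hl hl' hT
    have key : ∀ p ∈ N', V p ∨ D p →
        (Pi.single (c j) 1 - Pi.single (c j') 1 : α → ℝ) (c p)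
          = (Pi.single j 1 - Pi.single j' 1 : α → ℝ) p := by
      intro p hp hlp
      have e1 : c p = c j ↔ p = j := ⟨hinj p hp j (hA hj) hlp hl, fun h => by rw [h]⟩
      have e2 : c p = c j' ↔ p = j' := ⟨hinj p hp j' hj' hlp hl', fun h => by rw [h]⟩
      simp only [Pi.sub_apply, Pi.single_apply, e1, e2]
    exact hext' j hj j' hj' hj'A _ hT (fun p hp hVp => (key p hp (Or.inl hVp)).le)
      (fun p hp hDp => (key p hp (Or.inr hDp)).ge)
  have hfree : ∀ j ∈ A, ∀ j' ∈ N', j' ∉ A → ¬ D j → V j' := by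
    intro j hj j' hj' hj'A hDj
    by_contra hVj'
    refine hext' j hj j' hj' hj'A 0 h0 (fun p hp hVp => ?_) (fun p hp hDp => ?_)
    · have : p ≠ j' := fun h => hVj' (h ▸ hVp)
      simp only [Pi.sub_apply, Pi.single_apply, this, if_false, Pi.zero_apply]
      split_ifs <;> norm_num
    · have : p ≠ j := fun h => hDj (h ▸ hDp)
      simp only [Pi.sub_apply, Pi.single_apply, this, if_false, Pi.zero_apply]
      split_ifs <;> norm_num
  -- raising an unlinked or dominating entry while lowering a dominating one
  have hraise : ∀ j ∈ A, ∀ j' ∈ N', j' ∉ A → ¬ D j → V j' → ∀ k,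
      (∀ p ∈ N', V p → c p ≠ k) → ¬ T (Pi.single k 1 - Pi.single (c j') 1) := by
    intro j hj j' hj' hj'A hDj hVj' k hk hT
    refine hext' j hj j' hj' hj'A _ hT (fun p hp hVp => ?_) (fun p hp hDp => ?_)
    · have h1 := hk p hp hVp
      have e2 : c p = c j' ↔ p = j' :=
        ⟨hinj p hp j' hj' (Or.inl hVp) (Or.inl hVj'), fun h => by rw [h]⟩
      simp only [Pi.sub_apply, Pi.single_apply, e2, h1, if_false]
      split_ifs <;> norm_num
    · have h1 : p ≠ j := fun h => hDj (h ▸ hDp)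
      have h2 : c p ≠ c j' := fun h => by
        have := hinj p hp j' hj' (Or.inr hDp) (Or.inl hVj') h
        exact hVD j' hj' hVj' (this ▸ hDp)
      simp only [Pi.sub_apply, Pi.single_apply, h1, h2, if_false]
      split_ifs <;> norm_num
  have hlower : ∀ j ∈ A, ∀ j' ∈ N', j' ∉ A → D j → ¬ V j' → ∀ k,
      (∀ p ∈ N', D p → c p ≠ k) → ¬ T (Pi.single (c j) 1 - Pi.single k 1) := by
    intro j hj j' hj' hj'A hDj hVj' k hk hT
    refine hext' j hj j' hj' hj'A _ hT (fun p hp hVp => ?_) (fun p hp hDp => ?_)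
    · have h1 : p ≠ j' := fun h => hVj' (h ▸ hVp)
      have h2 : c p ≠ c j := fun h => by
        have := hinj p hp j (hA hj) (Or.inl hVp) (Or.inr hDj) h
        exact hVD p hp hVp (this ▸ hDj)
      simp only [Pi.sub_apply, Pi.single_apply, h1, h2, if_false]
      split_ifs <;> norm_num
    · have h1 := hk p hp hDp
      have e2 : c p = c j ↔ p = j :=
        ⟨hinj p hp j (hA hj) (Or.inr hDp) (Or.inr hDj), fun h => by rw [h]⟩
      simp only [Pi.sub_apply, Pi.single_apply, e2, h1, if_false]
      split_ifs <;> norm_num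
  by_cases hAD : ∀ j ∈ A, D j
  · by_cases hBV : ∀ j ∈ N', j ∉ A → V j
    · by_contra hcon
      push Not at hcon
      obtain ⟨h1, h2⟩ := hcon
      obtain ⟨k', hk', l', hl', hl'C, hT1⟩ := h1 hBV
      obtain ⟨k, hk, l, hl, hlC, hT2⟩ := h2 hAD
      simp only [Finset.mem_sdiff, Finset.mem_image, not_and, not_not] at hk' hl'C
      obtain ⟨j', ⟨hj', hj'A⟩, rfl⟩ := hl'C hl'
      obtain ⟨j, hj, rfl⟩ := Finset.mem_image.mp hk
      have hk'n : ∀ p ∈ N', c p ≠ k' := by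
        rintro p hp rfl
        by_cases hpA : p ∈ A
        · exact hnc p hpA j' hj' hj'A (Or.inr (hAD p hpA)) (Or.inl (hBV j' hj' hj'A)) hT1
        · exact hk'.2 ⟨p, ⟨hp, hpA⟩, rfl⟩
      have hln : ∀ p ∈ N', c p ≠ l := by
        rintro p hp rfl
        by_cases hpA : p ∈ A
        · exact hlC (Finset.mem_image_of_mem c hpA)
        · exact hnc j hj p hp hpA (Or.inr (hAD j hj)) (Or.inl (hBV p hp hpA)) hT2
      have key : ∀ p ∈ N', V p ∨ D p →
          ((Pi.single k' 1 - Pi.single (c j') 1) + (Pi.single (c j) 1 - Pi.single l 1) :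
            α → ℝ) (c p) = (Pi.single j 1 - Pi.single j' 1 : α → ℝ) p := by
        intro p hp hlp
        have e1 : c p = c j ↔ p = j :=
          ⟨hinj p hp j (hA hj) hlp (Or.inr (hAD j hj)), fun h => by rw [h]⟩
        have e2 : c p = c j' ↔ p = j' :=
          ⟨hinj p hp j' hj' hlp (Or.inl (hBV j' hj' hj'A)), fun h => by rw [h]⟩
        simp only [Pi.add_apply, Pi.sub_apply, Pi.single_apply, e1, e2, hk'n p hp, hln p hp,
          if_false]
        ring
      exact hext' j hj j' hj' hj'A _ (hadd _ _ hT1 hT2)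
        (fun p hp hVp => (key p hp (Or.inl hVp)).le) (fun p hp hDp => (key p hp (Or.inr hDp)).ge)
    · right
      refine ⟨hAD, ?_⟩
      push Not at hBV
      obtain ⟨j', hj', hj'A, hVj'⟩ := hBV
      intro k hk l hl hlC
      obtain ⟨j, hj, rfl⟩ := Finset.mem_image.mp hk
      by_cases hlD : ∃ p ∈ N', D p ∧ c p = l
      · obtain ⟨p, hp, hDp, rfl⟩ := hlD
        have hpA : p ∉ A := fun h => hlC (Finset.mem_image_of_mem c h)
        exact hnc j hj p hp hpA (Or.inr (hAD j hj)) (Or.inr hDp)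
      · push Not at hlD
        exact hlower j hj j' hj' hj'A (hAD j hj) hVj' l hlD
  · left
    push Not at hAD
    obtain ⟨j, hj, hDj⟩ := hAD
    have hBV : ∀ p ∈ N', p ∉ A → V p := fun p hp hpA => hfree j hj p hp hpA hDj
    refine ⟨hBV, ?_⟩
    intro k hk l hl hlC
    simp only [Finset.mem_sdiff, Finset.mem_image, not_and, not_not] at hk hlC
    obtain ⟨j', ⟨hj', hj'A⟩, rfl⟩ := hlC hl
    by_cases hkV : ∃ p ∈ N', V p ∧ c p = k
    · obtain ⟨p, hp, hVp, rfl⟩ := hkV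
      have hpA : p ∈ A := by
        by_contra h
        exact hk.2 ⟨p, ⟨hp, h⟩, rfl⟩
      exact hnc p hpA j' hj' hj'A (Or.inl hVp) (Or.inl (hBV j' hj' hj'A))
    · push Not at hkV
      exact hraise j hj j' hj' hj'A hDj (hBV j' hj' hj'A) k hkV

/-! ### Tangent directions at a pattern -/

/-- `d` moves only non-integral entries of the rows `≤ i` of the pattern `x`, keeps the row sums,
and weakly preserves the interlacing inequalities between the rows `≤ i` that are tight at `x`. -/
structure IsTangent {m : ℕ} (x : ℕ → Fin m → ℝ) (i : ℕ) (d : ℕ → Fin m → ℝ) : Prop where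
  supp : ∀ k j, IsIntegerReal (x k j) → d k j = 0
  zero : ∀ k, i < k → ∀ j, d k j = 0
  sum : ∀ k, ∑ j, d k j = 0
  vert : ∀ k < i, ∀ j, x k j = x (k + 1) j → d k j ≤ d (k + 1) j
  diag : ∀ k < i, ∀ j j' : Fin m, (j' : ℕ) = (j : ℕ) + 1 → x (k + 1) j' = x k j →
    d (k + 1) j' ≤ d k j

lemma IsTangent.of_zero {m : ℕ} (x : ℕ → Fin m → ℝ) (i : ℕ) : IsTangent x i 0 :=
  ⟨by simp, by simp, by simp, by simp, by simp⟩

lemma IsTangent.add {m : ℕ} {x : ℕ → Fin m → ℝ} {i : ℕ} {d e : ℕ → Fin m → ℝ}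
    (hd : IsTangent x i d) (he : IsTangent x i e) : IsTangent x i (d + e) where
  supp k j h := by simp [hd.supp k j h, he.supp k j h]
  zero k h j := by simp [hd.zero k h j, he.zero k h j]
  sum k := by simp [Finset.sum_add_distrib, hd.sum k, he.sum k]
  vert k hk j h := add_le_add (hd.vert k hk j h) (he.vert k hk j h)
  diag k hk j j' hj h := add_le_add (hd.diag k hk j j' hj h) (he.diag k hk j j' hj h)

lemma IsTangent.update {m : ℕ} {x : ℕ → Fin m → ℝ} {i : ℕ} {d : ℕ → Fin m → ℝ}
    (hd : IsTangent x i d) (r : Fin m → ℝ) (hr : ∀ j, IsIntegerReal (x (i + 1) j) → r j = 0)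
    (hsum : ∑ j, r j = 0) (hvert : ∀ j, x i j = x (i + 1) j → d i j ≤ r j)
    (hdiag : ∀ j j' : Fin m, (j' : ℕ) = (j : ℕ) + 1 → x (i + 1) j' = x i j → r j' ≤ d i j) :
    IsTangent x (i + 1) (Function.update d (i + 1) r) where
  supp k j h := by
    by_cases hk : k = i + 1
    · subst hk; simpa using hr j h
    · simpa [hk] using hd.supp k j h
  zero k h j := by
    simpa [h.ne'] using hd.zero k (by omega) j
  sum k := by
    by_cases hk : k = i + 1
    · subst hk; simpa using hsum
    · simpa [hk] using hd.sum k
  vert k hk j h := by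
    have h1 : k ≠ i + 1 := by omega
    by_cases hki : k = i
    · subst hki; simpa using hvert j h
    · simpa [h1, hki] using hd.vert k (by omega) j h
  diag k hk j j' hj h := by
    have h1 : k ≠ i + 1 := by omega
    by_cases hki : k = i
    · subst hki; simpa using hdiag j j' hj h
    · simpa [h1, hki] using hd.diag k (by omega) j j' hj h

open Classical in
/-- If the non-integral entries of each row are distinct, a set of non-integral entries that
cannot be exchanged with the others has integral sum. -/
lemma isIntegerReal_sum_of_closed {m : ℕ} (x : ℕ → Fin m → ℝ) (n : ℕ)
    (hrow0 : ∀ j, IsIntegerReal (x 0 j)) (hsum : ∀ i ≤ n, IsIntegerReal (∑ j, x i j))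
    (hdist : ∀ i j j', ¬ IsIntegerReal (x i j) → x i j = x i j' → j = j')
    (i : ℕ) (hi : i ≤ n) (A : Finset (Fin m)) (hA : ∀ j ∈ A, ¬ IsIntegerReal (x i j))
    (hcl : ∀ j ∈ A, ∀ j', ¬ IsIntegerReal (x i j') → j' ∉ A →
      ¬ ∃ d, IsTangent x i d ∧ d i = Pi.single j 1 - Pi.single j' 1) :
    IsIntegerReal (∑ j ∈ A, x i j) := by
  have hsumN : ∀ i ≤ n, IsIntegerReal (∑ j with ¬ IsIntegerReal (x i j), x i j) := by
    intro i hi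
    have h := Finset.sum_filter_add_sum_filter_not Finset.univ
      (fun j => IsIntegerReal (x i j)) (x i)
    rw [← eq_sub_iff_add_eq'] at h
    rw [h]
    exact (hsum i hi).sub (IsIntegerReal.sum _ _ (by simp))
  induction i generalizing A with
  | zero =>
    exact IsIntegerReal.sum _ _ fun j _ => hrow0 j
  | succ i ih =>
    set N : Finset (Fin m) := Finset.univ.filter fun j => ¬ IsIntegerReal (x i j) with hN
    set N' : Finset (Fin m) := Finset.univ.filter fun j => ¬ IsIntegerReal (x (i + 1) j) with hN'
    let V : Fin m → Prop := fun j => x i j = x (i + 1) j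
    let D : Fin m → Prop := fun j => ∃ k : Fin m, (j : ℕ) = (k : ℕ) + 1 ∧ x (i + 1) j = x i k
    let c : Fin m → Fin m := fun j => if V j then j else ⟨j - 1, by omega⟩
    have hVD : ∀ j ∈ N', V j → ¬ D j := by
      rintro j hj hV ⟨k, hjk, hk⟩
      have := hdist i j k (by rw [show x i j = _ from hV]; simpa [hN'] using hj) (hV.trans hk)
      rw [this] at hjk
      omega
    have hcD : ∀ j ∈ N', ∀ k : Fin m, (j : ℕ) = (k : ℕ) + 1 → x (i + 1) j = x i k → c j = k := by
      intro j hj k hjk hk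
      have : ¬ V j := fun h => hVD j hj h ⟨k, hjk, hk⟩
      simp only [c, this, if_false]
      ext
      simp [hjk]
    have hval : ∀ j ∈ N', V j ∨ D j → x i (c j) = x (i + 1) j := by
      rintro j hj (hV | ⟨k, hjk, hk⟩)
      · have hcj : c j = j := if_pos hV
        rw [hcj]
        exact hV
      · rw [hcD j hj k hjk hk, hk]
    have hinj : ∀ j ∈ N', ∀ j' ∈ N', V j ∨ D j → V j' ∨ D j' → c j = c j' → j = j' := by
      intro j hj j' hj' h h' hcc
      refine hdist (i + 1) j j' (by simpa [hN'] using hj) ?_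
      rw [← hval j hj h, ← hval j' hj' h', hcc]
    have hAN' : A ⊆ N' := fun j hj => by simpa [hN'] using hA j hj
    have key := exists_closed_of_closed N N' V D c hVD hinj
      (fun u => ∃ d, IsTangent x i d ∧ d i = u)
      (fun r => ∃ d, IsTangent x (i + 1) d ∧ d (i + 1) = r)
      ⟨0, IsTangent.of_zero x i, rfl⟩
      (by
        rintro u v ⟨d, hd, rfl⟩ ⟨e, he, rfl⟩
        exact ⟨d + e, hd.add he, rfl⟩)
      (by
        rintro u r ⟨d, hd, rfl⟩ hr hrsum hV hD
        have hr' : ∀ j, IsIntegerReal (x (i + 1) j) → r j = 0 := fun j hj =>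
          hr j (by simpa [hN'] using hj)
        refine ⟨Function.update d (i + 1) r, hd.update r hr' hrsum ?_ ?_, by simp⟩
        · intro j hj
          by_cases hI : IsIntegerReal (x (i + 1) j)
          · rw [hr' j hI, hd.supp i j (hj ▸ hI)]
          · have := hV j (by simpa [hN'] using hI) hj
            have hcj : c j = j := if_pos hj
            rwa [hcj] at this
        · intro j j' hjj' hj
          by_cases hI : IsIntegerReal (x (i + 1) j')
          · rw [hr' j' hI, hd.supp i j (hj ▸ hI)]
          · have hj'N : j' ∈ N' := by simpa [hN'] using hI
            have := hD j' hj'N ⟨j, hjj', hj⟩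
            rwa [hcD j' hj'N j hjj' hj] at this)
      A hAN'
      (fun j hj j' hj' hj'A => hcl j hj j' (by simpa [hN'] using hj') hj'A)
    have himage : ∀ B ⊆ N', (∀ j ∈ B, V j ∨ D j) →
        ∑ k ∈ B.image c, x i k = ∑ j ∈ B, x (i + 1) j := by
      intro B hB hVB
      rw [Finset.sum_image fun j hj j' hj' h =>
        hinj j (hB hj) j' (hB hj') (hVB j hj) (hVB j' hj') h]
      exact Finset.sum_congr rfl fun j hj => hval j (hB hj) (hVB j hj)
    have hmem : ∀ B ⊆ N', (∀ j ∈ B, V j ∨ D j) → B.image c ⊆ N := by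
      intro B hB hVB k hk
      obtain ⟨j, hj, rfl⟩ := Finset.mem_image.mp hk
      simp only [hN, Finset.mem_filter, Finset.mem_univ, true_and]
      rw [hval j (hB hj) (hVB j hj)]
      simpa [hN'] using hB hj
    rcases key with ⟨hV, hC⟩ | ⟨hD, hC⟩
    · have hVB : ∀ j ∈ N' \ A, V j ∨ D j := fun j hj =>
        Or.inl (hV j (Finset.mem_sdiff.mp hj).1 (Finset.mem_sdiff.mp hj).2)
      have h1 := ih (by omega) (N \ (N' \ A).image c)
        (fun j hj => by simpa [hN] using (Finset.mem_sdiff.mp hj).1)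
        (fun k hk l hl hlC => hC k hk l (by simpa [hN] using hl) hlC)
      have h2 := Finset.sum_sdiff (f := x i) (hmem _ Finset.sdiff_subset hVB)
      rw [himage _ Finset.sdiff_subset hVB] at h2
      have h3 := Finset.sum_sdiff (f := x (i + 1)) hAN'
      have h4 := (hsumN (i + 1) hi).sub ((hsumN i (by omega)).sub h1)
      convert h4 using 1
      rw [← hN, ← hN']
      linarith
    · have hVA : ∀ j ∈ A, V j ∨ D j := fun j hj => Or.inr (hD j hj)
      rw [← himage A hAN' hVA]
      exact ih (by omega) _ (fun j hj => by simpa [hN] using hmem A hAN' hVA hj)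
        (fun k hk l hl hlC => hC k hk l (by simpa [hN] using hl) hlC)

/-! ### Small perturbations -/

open Filter Topology in
lemma eventually_add_mul_le {u v s t : ℝ} (h : u ≤ v) (hst : u = v → s ≤ t) :
    ∀ᶠ ε in 𝓝[>] (0 : ℝ), u + ε * s ≤ v + ε * t := by
  rcases h.eq_or_lt with h | h
  · filter_upwards [self_mem_nhdsWithin] with ε hε
    have := mul_le_mul_of_nonneg_left (hst h) (le_of_lt hε)
    linarith
  · have h1 : Tendsto (fun ε : ℝ => u + ε * s) (𝓝[>] 0) (𝓝 u) :=
      Tendsto.mono_left (Continuous.tendsto' (by fun_prop) _ _ (by simp)) nhdsWithin_le_nhds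
    have h2 : Tendsto (fun ε : ℝ => v + ε * t) (𝓝[>] 0) (𝓝 v) :=
      Tendsto.mono_left (Continuous.tendsto' (by fun_prop) _ _ (by simp)) nhdsWithin_le_nhds
    filter_upwards [h1.eventually_lt h2 h] with ε hε using hε.le

open Filter Topology in
lemma eventually_add_mul_ne {u v s t : ℝ} (h : u = v → s ≠ t) :
    ∀ᶠ ε in 𝓝[>] (0 : ℝ), u + ε * s ≠ v + ε * t := by
  by_cases huv : u = v
  · filter_upwards [self_mem_nhdsWithin] with ε hε heq
    rw [huv] at heq
    exact h huv (mul_left_cancel₀ (ne_of_gt hε) (add_left_cancel heq))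
  · have h1 : Tendsto (fun ε : ℝ => u + ε * s) (𝓝[>] 0) (𝓝 u) :=
      Tendsto.mono_left (Continuous.tendsto' (by fun_prop) _ _ (by simp)) nhdsWithin_le_nhds
    have h2 : Tendsto (fun ε : ℝ => v + ε * t) (𝓝[>] 0) (𝓝 v) :=
      Tendsto.mono_left (Continuous.tendsto' (by fun_prop) _ _ (by simp)) nhdsWithin_le_nhds
    rcases lt_or_gt_of_ne huv with h | h
    · filter_upwards [h1.eventually_lt h2 h] with ε hε using hε.ne
    · filter_upwards [h2.eventually_lt h1 h] with ε hε using hε.ne'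

/-! ### Basic properties of flagged Gelfand–Tsetlin patterns -/

section Pattern

variable {m n : ℕ} {lam mu : Fin m → ℕ} {nu : ℕ → ℕ} {a b : Fin m → ℕ} {X : ℕ → Fin m → ℝ}

lemma eq_mu_of_lt_flag (hX : X ∈ flaggedGTPolytope n lam mu nu a b) {i : ℕ} {j : Fin m}
    (hi : i ≤ n) (hij : i < a j) : X i j = mu j := by
  obtain ⟨-, h0, -, -, -, hf, -⟩ := hX
  induction i with
  | zero => exact h0 j
  | succ i ih =>
    rw [hf (i + 1) (by omega) hi j (by simp; omega), Nat.add_sub_cancel]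
    exact ih (by omega) (by omega)

lemma eq_lam_of_flag_le (hX : X ∈ flaggedGTPolytope n lam mu nu a b) {i : ℕ} {j : Fin m}
    (hi : i ≤ n) (hij : b j ≤ i) : X i j = lam j := by
  obtain ⟨hn, -, -, -, -, hf, -⟩ := hX
  induction hi using Nat.decreasingInduction with
  | self => exact hn j
  | of_succ i hi ih =>
    rw [← ih (by omega), hf (i + 1) (by omega) hi j (by simp; omega), Nat.add_sub_cancel]

lemma isIntegerReal_of_notMem_flag (hX : X ∈ flaggedGTPolytope n lam mu nu a b) {i : ℕ}
    {j : Fin m} (h1 : 1 ≤ i) (hi : i ≤ n) (hij : i ∉ Finset.Icc (a j) (b j)) :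
    IsIntegerReal (X i j) ∧ IsIntegerReal (X (i - 1) j) := by
  have : i < a j ∨ b j ≤ i - 1 := by
    simp only [Finset.mem_Icc, not_and_or, not_le] at hij
    omega
  rcases this with h | h
  · rw [eq_mu_of_lt_flag hX hi h, eq_mu_of_lt_flag hX (i := i - 1) (by omega) (by omega)]
    exact ⟨.natCast _, .natCast _⟩
  · rw [eq_lam_of_flag_le hX hi (by omega), eq_lam_of_flag_le hX (i := i - 1) (by omega) h]
    exact ⟨.natCast _, .natCast _⟩

lemma isIntegerReal_row_sum (hX : X ∈ flaggedGTPolytope n lam mu nu a b) {i : ℕ} (hi : i ≤ n) :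
    IsIntegerReal (∑ j, X i j) := by
  obtain ⟨-, h0, -, -, -, -, hs⟩ := hX
  induction i with
  | zero => exact IsIntegerReal.sum _ _ fun j _ => by rw [h0]; exact .natCast _
  | succ i ih =>
    have h := hs (i + 1) (by omega) hi
    rw [Finset.sum_sub_distrib, Nat.add_sub_cancel, sub_eq_iff_eq_add] at h
    rw [h]
    exact (IsIntegerReal.natCast _).add (ih (by omega))

lemma mu_le_entry (hX : X ∈ flaggedGTPolytope n lam mu nu a b) {i : ℕ} (hi : i ≤ n)
    (j : Fin m) : (mu j : ℝ) ≤ X i j := by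
  obtain ⟨-, h0, -, hv, -⟩ := hX
  induction i with
  | zero => exact (h0 j).ge
  | succ i ih => exact (ih (by omega)).trans (hv i hi j)

lemma entry_le_lam (hX : X ∈ flaggedGTPolytope n lam mu nu a b) {i : ℕ} (hi : i ≤ n)
    (j : Fin m) : X i j ≤ lam j := by
  obtain ⟨hn, -, -, hv, -⟩ := hX
  induction hi using Nat.decreasingInduction with
  | self => exact (hn j).le
  | of_succ i hi ih => exact (hv i hi j).trans ih

lemma antitone_of_adjacent_le {r : Fin m → ℝ}
    (h : ∀ j j' : Fin m, (j' : ℕ) = (j : ℕ) + 1 → r j' ≤ r j) : Antitone r := by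
  have key : ∀ t : ℕ, ∀ j j' : Fin m, (j' : ℕ) = (j : ℕ) + t → r j' ≤ r j := by
    intro t
    induction t with
    | zero => intro j j' hj; exact (congrArg r (Fin.ext (by simpa using hj))).le
    | succ t ih =>
      intro j j' hj
      exact (h ⟨j + t, by omega⟩ j' (by simp; omega)).trans (ih j _ rfl)
  intro j j' hj
  exact key (j' - j) j j' (by have : (j : ℕ) ≤ j' := hj; omega)

lemma antitone_row (hlam : Antitone lam) (hX : X ∈ flaggedGTPolytope n lam mu nu a b) {i : ℕ}
    (hi : i ≤ n) : Antitone (X i) := by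
  obtain ⟨hn, -, -, hv, hd, -⟩ := hX
  rcases hi.eq_or_lt with rfl | hi
  · intro j j' hj
    rw [hn, hn]
    exact_mod_cast hlam hj
  · exact antitone_of_adjacent_le fun j j' hj => (hv i hi j').trans (hd i hi j j' hj)

lemma isClosed_flaggedGTPolytope : IsClosed (flaggedGTPolytope n lam mu nu a b) := by
  have hc : ∀ i j, Continuous fun X : ℕ → Fin m → ℝ => X i j := fun i j => by fun_prop
  simp only [flaggedGTPolytope, Set.ofPred_and, Set.ofPred_forall]
  refine (isClosed_iInter fun j => isClosed_eq (hc _ _) continuous_const).inter <|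
    (isClosed_iInter fun j => isClosed_eq (hc _ _) continuous_const).inter <|
    (isClosed_iInter fun i => isClosed_iInter fun _ => isClosed_iInter fun j =>
      isClosed_eq (hc _ _) continuous_const).inter <|
    (isClosed_iInter fun i => isClosed_iInter fun _ => isClosed_iInter fun j =>
      isClosed_le (hc _ _) (hc _ _)).inter <|
    (isClosed_iInter fun i => isClosed_iInter fun _ => isClosed_iInter fun j =>
      isClosed_iInter fun j' => isClosed_iInter fun _ => isClosed_le (hc _ _) (hc _ _)).inter <|
    (isClosed_iInter fun i => isClosed_iInter fun _ => isClosed_iInter fun _ =>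
      isClosed_iInter fun j => isClosed_iInter fun _ => isClosed_eq (hc _ _) (hc _ _)).inter <|
    (isClosed_iInter fun i => isClosed_iInter fun _ => isClosed_iInter fun _ =>
      isClosed_eq (by fun_prop) continuous_const)

lemma isCompact_flaggedGTPolytope : IsCompact (flaggedGTPolytope n lam mu nu a b) := by
  refine (isCompact_univ_pi fun i : ℕ => isCompact_univ_pi fun j : Fin m =>
    isCompact_Icc (a := (mu j : ℝ)) (b := (lam j : ℝ))).of_isClosed_subset
    isClosed_flaggedGTPolytope ?_
  intro X hX i _ j _
  rcases le_or_gt i n with hi | hi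
  · exact ⟨mu_le_entry hX hi j, entry_le_lam hX hi j⟩
  · rw [hX.2.2.1 i hi j]
    exact ⟨(mu_le_entry hX le_rfl j).trans (entry_le_lam hX le_rfl j), le_rfl⟩

lemma IsTangent.vert_of_mem {i : ℕ} {d : ℕ → Fin m → ℝ} (hd : IsTangent X i d)
    (hint : ∀ k, i < k → ∀ j, IsIntegerReal (X k j)) (k : ℕ) (j : Fin m)
    (h : X k j = X (k + 1) j) : d k j ≤ d (k + 1) j := by
  by_cases hk : k < i
  · exact hd.vert k hk j h
  · have := hint (k + 1) (by omega) j
    rw [hd.supp _ _ this, hd.supp _ _ (h ▸ this)]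

lemma IsTangent.diag_of_mem {i : ℕ} {d : ℕ → Fin m → ℝ} (hd : IsTangent X i d)
    (hint : ∀ k, i < k → ∀ j, IsIntegerReal (X k j)) (k : ℕ) (j j' : Fin m)
    (hj : (j' : ℕ) = (j : ℕ) + 1) (h : X (k + 1) j' = X k j) : d (k + 1) j' ≤ d k j := by
  by_cases hk : k < i
  · exact hd.diag k hk j j' hj h
  · have := hint (k + 1) (by omega) j'
    rw [hd.supp _ _ this, hd.supp _ _ (h ▸ this)]

open Filter Topology in
/-- Tangent directions stay in the polytope for a short time. -/
lemma IsTangent.eventually_add_smul_mem (hX : X ∈ flaggedGTPolytope n lam mu nu a b) {i : ℕ}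
    {d : ℕ → Fin m → ℝ} (hd : IsTangent X i d)
    (hint : ∀ k, i < k → ∀ j, IsIntegerReal (X k j)) :
    ∀ᶠ ε in 𝓝[>] (0 : ℝ), X + ε • d ∈ flaggedGTPolytope n lam mu nu a b := by
  have hflag := fun i j => isIntegerReal_of_notMem_flag hX (i := i) (j := j)
  obtain ⟨hn, h0, hgt, hv, hdg, hf, hs⟩ := hX
  have ev1 : ∀ᶠ ε in 𝓝[>] (0 : ℝ), ∀ k ∈ Finset.range n, ∀ j,
      X k j + ε * d k j ≤ X (k + 1) j + ε * d (k + 1) j := by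
    rw [Filter.eventually_all_finset]
    intro k hk
    rw [Filter.eventually_all]
    intro j
    exact eventually_add_mul_le (hv k (Finset.mem_range.mp hk) j) (hd.vert_of_mem hint k j)
  have ev2 : ∀ᶠ ε in 𝓝[>] (0 : ℝ), ∀ k ∈ Finset.range n, ∀ j j' : Fin m,
      (j' : ℕ) = (j : ℕ) + 1 → X (k + 1) j' + ε * d (k + 1) j' ≤ X k j + ε * d k j := by
    rw [Filter.eventually_all_finset]
    intro k hk
    rw [Filter.eventually_all]
    intro j
    rw [Filter.eventually_all]
    intro j'
    rw [Filter.eventually_imp_distrib_left]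
    intro hj
    exact eventually_add_mul_le (hdg k (Finset.mem_range.mp hk) j j' hj)
      (hd.diag_of_mem hint k j j' hj)
  filter_upwards [ev1, ev2] with ε h1 h2
  refine ⟨fun j => ?_, fun j => ?_, fun k hk j => ?_, fun k hk j => ?_, fun k hk j j' hj => ?_,
    fun k h1k hk j hkj => ?_, fun k h1k hk => ?_⟩
  · have := hd.supp n j (hn j ▸ .natCast _)
    simp [this, hn]
  · have := hd.supp 0 j (h0 j ▸ .natCast _)
    simp [this, h0]
  · have := hd.supp k j (hgt k hk j ▸ .natCast _)
    simp [this, hgt k hk j]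
  · simpa using h1 k (Finset.mem_range.mpr hk) j
  · simpa using h2 k (Finset.mem_range.mpr hk) j j' hj
  · have h3 := hflag k j h1k hk hkj
    simp [hd.supp _ _ h3.1, hd.supp _ _ h3.2, hf k h1k hk j hkj]
  · have e : ∀ k, ∑ j, (X + ε • d) k j = ∑ j, X k j := by
      intro k
      simp [Finset.sum_add_distrib, ← Finset.mul_sum, hd.sum k]
    rw [Finset.sum_sub_distrib, e, e, ← Finset.sum_sub_distrib]
    exact hs k h1k hk

end Pattern

/-! ### Lexicographic minima of the polytope -/

section LexMin

variable {m n : ℕ} {lam mu : Fin m → ℕ} {nu : ℕ → ℕ} {a b : Fin m → ℕ} {p : ℕ → Fin m → ℝ}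

lemma exists_isLexSmallest (hne : (flaggedGTPolytope n lam mu nu a b).Nonempty) :
    ∃ p, IsLexSmallest n (flaggedGTPolytope n lam mu nu a b) p := by
  rcases Nat.eq_zero_or_pos m with rfl | hm
  · obtain ⟨p, hp⟩ := hne
    exact ⟨p, hp, fun q _ hqp => (hqp (by ext i j; exact j.elim0)).elim⟩
  obtain ⟨p, hp, hmin⟩ := isCompact_flaggedGTPolytope.exists_lex_min hne
    (fun k X => X (n - k / m) ⟨k % m, Nat.mod_lt k hm⟩) (fun k => by fun_prop) ((n + 1) * m)
  have hdm : ∀ (t : ℕ) (j : Fin m), (t * m + j) / m = t ∧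
      (⟨(t * m + j) % m, Nat.mod_lt _ hm⟩ : Fin m) = j := by
    intro t j
    constructor
    · rw [Nat.add_comm, Nat.add_mul_div_right _ _ hm, Nat.div_eq_of_lt j.2, Nat.zero_add]
    · ext
      simp [Nat.add_comm (t * m), Nat.mod_eq_of_lt j.2]
  refine ⟨p, hp, fun q hq hqp => ?_⟩
  rcases hmin q hq with h | ⟨k, hk, hlt, heq⟩
  · refine (hqp ?_).elim
    ext i j
    rcases le_or_gt i n with hi | hi
    · have hlt : (n - i) * m + j < (n + 1) * m := by
        have h1 : (n - i + 1) * m ≤ (n + 1) * m := Nat.mul_le_mul_right m (by omega)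
        have h2 := j.2
        rw [Nat.add_mul, Nat.one_mul] at h1
        omega
      have := h _ hlt
      simp only [(hdm (n - i) j).1, (hdm (n - i) j).2, Nat.sub_sub_self hi] at this
      exact this.symm
    · rw [hp.2.2.1 i hi j, hq.2.2.1 i hi j]
  · have hkn : k / m < n + 1 := Nat.div_lt_of_lt_mul (by rwa [Nat.mul_comm])
    refine ⟨k / m, ⟨k % m, Nat.mod_lt k hm⟩, by omega, hlt, fun t j _ htj => ?_⟩
    have hl : t * m + j < k := by
      have h0 := Nat.div_add_mod k m
      rw [Nat.mul_comm] at h0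
      rcases htj with ht | ⟨rfl, hj⟩
      · have h1 : (t + 1) * m ≤ k / m * m := Nat.mul_le_mul_right m ht
        have h2 := j.2
        rw [Nat.add_mul, Nat.one_mul] at h1
        omega
      · have : (j : ℕ) < k % m := hj
        omega
    have := heq _ hl
    simpa only [(hdm t j).1, (hdm t j).2] using this

lemma IsLexSmallest.mem_extremePoints {S : Set (ℕ → Fin m → ℝ)} (hp : IsLexSmallest n S p) :
    p ∈ Set.extremePoints ℝ S := by
  refine ⟨hp.1, fun y hy z hz hyz => ?_⟩
  by_contra hyp
  obtain ⟨r, s, hr, hs, hrs, rfl⟩ := hyz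
  obtain ⟨t, j, ht, hlt, heq⟩ := hp.2 y hy hyp
  have hval : ∀ i j, (r • y + s • z) i j = r * y i j + s * z i j := fun i j => by simp
  have hz' : ∀ i j, (r • y + s • z) i j = y i j → (r • y + s • z) i j = z i j := by
    intro i j h
    rw [hval] at h ⊢
    have h1 : s * (z i j - y i j) = 0 := by
      rw [show r = 1 - s by linarith] at h
      linarith
    have h2 : z i j = y i j := by
      rcases mul_eq_zero.mp h1 with h | h
      · exact (hs.ne' h).elim
      · linarith
    rw [h2, ← add_mul, hrs, one_mul]
  have hzlt : z (n - t) j < (r • y + s • z) (n - t) j := by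
    rw [hval] at hlt ⊢
    have h1 : s * z (n - t) j < s * y (n - t) j := by
      rw [show r = 1 - s by linarith] at hlt
      linarith
    have h2 := lt_of_mul_lt_mul_left h1 hs.le
    have h3 := mul_lt_mul_of_pos_left h2 hr
    rw [show s = 1 - r by linarith]
    linarith
  have hzp : z ≠ r • y + s • z := fun h => hzlt.ne (congrFun (congrFun h _) _)
  obtain ⟨t', j', ht', hlt', heq'⟩ := hp.2 z hz hzp
  rcases lt_trichotomy t t' with h | rfl | h
  · exact hzlt.ne' (heq' t j ht (Or.inl h))
  · rcases lt_trichotomy j j' with h | rfl | h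
    · exact hzlt.ne' (heq' t j ht (Or.inr ⟨rfl, h⟩))
    · exact lt_asymm hzlt hlt'
    · exact hlt'.ne (hz' _ _ (heq t j' ht' (Or.inr ⟨rfl, h⟩)))
  · exact hlt'.ne (hz' _ _ (heq t' j' ht' (Or.inl h)))

/-- The non-integral entries of a row next to an integral row above it are distinct. -/
lemma eq_of_isIntegerReal_succ (hlam : Antitone lam)
    (hp : p ∈ flaggedGTPolytope n lam mu nu a b) {i : ℕ} (hi : i < n)
    (hint : ∀ j, IsIntegerReal (p (i + 1) j)) {j j' : Fin m} (hj : ¬ IsIntegerReal (p i j))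
    (h : p i j = p i j') : j = j' := by
  have key : ∀ j j' : Fin m, ¬ IsIntegerReal (p i j) → p i j = p i j' → ¬ j < j' := by
    intro j j' hj h hlt
    have hlt' : (j : ℕ) < j' := hlt
    let k : Fin m := ⟨j + 1, by omega⟩
    have h1 : p (i + 1) k ≤ p i j := hp.2.2.2.2.1 i hi j k rfl
    have h2 : p i k ≤ p (i + 1) k := hp.2.2.2.1 i hi k
    have h3 : p i j' ≤ p i k := antitone_row hlam hp hi.le (show (k : ℕ) ≤ j' by simp [k]; omega)
    exact hj (by rw [show p i j = p (i + 1) k by linarith]; exact hint k)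
  rcases lt_trichotomy j j' with hlt | rfl | hlt
  · exact (key j j' hj h hlt).elim
  · rfl
  · exact (key j' j (h ▸ hj) h.symm hlt).elim

open Classical in
/-- The direction spreading apart equal non-integral entries of each row: each such entry moves
up by the number of equal entries to its right, and down by the number of those to its left. -/
noncomputable def spread (x : ℕ → Fin m → ℝ) (k : ℕ) (j : Fin m) : ℝ :=
  if IsIntegerReal (x k j) then 0 else
    ((Finset.univ.filter fun j' => j < j' ∧ x k j' = x k j).card : ℝ) -
      (Finset.univ.filter fun j' => j' < j ∧ x k j' = x k j).card

lemma spread_of_isIntegerReal {x : ℕ → Fin m → ℝ} {k : ℕ} {j : Fin m}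
    (h : IsIntegerReal (x k j)) : spread x k j = 0 := if_pos h

lemma spread_of_not_isIntegerReal {x : ℕ → Fin m → ℝ} {k : ℕ} {j : Fin m}
    (h : ¬ IsIntegerReal (x k j)) : spread x k j =
    ((Finset.univ.filter fun j' => j < j' ∧ x k j' = x k j).card : ℝ) -
      (Finset.univ.filter fun j' => j' < j ∧ x k j' = x k j).card := by
  rw [spread, if_neg h]

lemma sum_spread (x : ℕ → Fin m → ℝ) (k : ℕ) : ∑ j, spread x k j = 0 := by
  classical
  have h : ∀ j, spread x k j =
      ∑ j', (if ¬ IsIntegerReal (x k j) ∧ j < j' ∧ x k j' = x k j then (1 : ℝ) else 0) -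
      ∑ j', (if ¬ IsIntegerReal (x k j) ∧ j' < j ∧ x k j' = x k j then (1 : ℝ) else 0) := by
    intro j
    by_cases hj : IsIntegerReal (x k j)
    · simp [spread_of_isIntegerReal hj, hj]
    · rw [spread_of_not_isIntegerReal hj]
      simp [hj]
  rw [Finset.sum_congr rfl fun j _ => h j, Finset.sum_sub_distrib, sub_eq_zero, Finset.sum_comm]
  refine Finset.sum_congr rfl fun j _ => Finset.sum_congr rfl fun j' _ => if_congr ?_ rfl rfl
  constructor <;> rintro ⟨h1, h2, h3⟩
  · exact ⟨h3 ▸ h1, h2, h3.symm⟩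
  · exact ⟨h3 ▸ h1, h2, h3.symm⟩

lemma spread_lt_spread {x : ℕ → Fin m → ℝ} {k : ℕ} {j j' : Fin m} (hj : ¬ IsIntegerReal (x k j))
    (h : x k j = x k j') (hlt : j < j') : spread x k j' < spread x k j := by
  rw [spread_of_not_isIntegerReal hj, spread_of_not_isIntegerReal (h ▸ hj)]
  have h1 : (Finset.univ.filter fun l => j' < l ∧ x k l = x k j').card <
      (Finset.univ.filter fun l => j < l ∧ x k l = x k j).card := by
    apply Finset.card_lt_card
    rw [Finset.ssubset_iff_of_subset]
    · exact ⟨j', by simp [hlt, h], by simp⟩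
    · intro l hl
      simp only [Finset.mem_filter, Finset.mem_univ, true_and] at hl ⊢
      exact ⟨hlt.trans hl.1, hl.2.trans h.symm⟩
  have h2 : (Finset.univ.filter fun l => l < j ∧ x k l = x k j).card ≤
      (Finset.univ.filter fun l => l < j' ∧ x k l = x k j').card := by
    apply Finset.card_le_card
    intro l hl
    simp only [Finset.mem_filter, Finset.mem_univ, true_and] at hl ⊢
    exact ⟨hl.1.trans hlt, hl.2.trans h⟩
  have h1' : ((Finset.univ.filter fun l => j' < l ∧ x k l = x k j').card : ℝ) <
      (Finset.univ.filter fun l => j < l ∧ x k l = x k j).card := by exact_mod_cast h1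
  have h2' : ((Finset.univ.filter fun l => l < j ∧ x k l = x k j).card : ℝ) ≤
      (Finset.univ.filter fun l => l < j' ∧ x k l = x k j').card := by exact_mod_cast h2
  linarith

lemma isTangent_spread (hlam : Antitone lam) (hp : p ∈ flaggedGTPolytope n lam mu nu a b) {i : ℕ}
    (hi : i ≤ n) (hint : ∀ k, i < k → ∀ j, IsIntegerReal (p k j)) :
    IsTangent p i (spread p) where
  supp k j h := spread_of_isIntegerReal h
  zero k hk j := spread_of_isIntegerReal (hint k hk j)
  sum k := sum_spread p k
  vert k hk j h := by
    have hv := hp.2.2.2.1 k (by omega)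
    by_cases hj : IsIntegerReal (p k j)
    · rw [spread_of_isIntegerReal hj, spread_of_isIntegerReal (h ▸ hj)]
    rw [spread_of_not_isIntegerReal hj, spread_of_not_isIntegerReal (h ▸ hj)]
    have h1 : (Finset.univ.filter fun l => j < l ∧ p k l = p k j).card ≤
        (Finset.univ.filter fun l => j < l ∧ p (k + 1) l = p (k + 1) j).card := by
      apply Finset.card_le_card
      intro l hl
      simp only [Finset.mem_filter, Finset.mem_univ, true_and] at hl ⊢
      have := hv l
      have := antitone_row hlam hp (i := k + 1) (by omega) hl.1.le
      exact ⟨hl.1, by linarith [hl.2]⟩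
    have h2 : (Finset.univ.filter fun l => l < j ∧ p (k + 1) l = p (k + 1) j).card ≤
        (Finset.univ.filter fun l => l < j ∧ p k l = p k j).card := by
      apply Finset.card_le_card
      intro l hl
      simp only [Finset.mem_filter, Finset.mem_univ, true_and] at hl ⊢
      have := hv l
      have := antitone_row hlam hp (i := k) (by omega) hl.1.le
      exact ⟨hl.1, by linarith [hl.2]⟩
    have h1' := (Nat.cast_le (α := ℝ)).mpr h1
    have h2' := (Nat.cast_le (α := ℝ)).mpr h2
    linarith
  diag k hk j j' hjj' h := by
    have hd := hp.2.2.2.2.1 k (by omega)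
    have ha := antitone_row hlam hp (i := k) (by omega)
    have ha' := antitone_row hlam hp (i := k + 1) (by omega)
    by_cases hj : IsIntegerReal (p k j)
    · rw [spread_of_isIntegerReal hj, spread_of_isIntegerReal (h ▸ hj)]
    rw [spread_of_not_isIntegerReal hj, spread_of_not_isIntegerReal (h ▸ hj)]
    have h1 : (Finset.univ.filter fun l => j' < l ∧ p (k + 1) l = p (k + 1) j').card ≤
        (Finset.univ.filter fun l => j < l ∧ p k l = p k j).card := by
      apply Finset.card_le_card_of_injOn fun l => ⟨l - 1, by omega⟩
      · intro l hl
        simp only [Finset.coe_filter, Finset.mem_univ, true_and, Set.mem_ofPred_eq] at hl ⊢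
        have hlt : (j' : ℕ) < l := hl.1
        have hlt' : j < (⟨l - 1, by omega⟩ : Fin m) := Fin.mk_lt_mk.mpr (by omega)
        have := hd ⟨l - 1, by omega⟩ l (by simp; omega)
        have := ha hlt'.le
        exact ⟨hlt', by linarith [hl.2]⟩
      · intro l hl l' hl' hll
        simp only [Finset.coe_filter, Finset.mem_univ, true_and, Set.mem_ofPred_eq] at hl hl'
        have h3 : (j' : ℕ) < l := hl.1
        have h4 : (j' : ℕ) < l' := hl'.1
        have h5 := Fin.mk.inj_iff.mp hll
        ext
        omega
    have h2 : (Finset.univ.filter fun l => l < j ∧ p k l = p k j).card ≤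
        (Finset.univ.filter fun l => l < j' ∧ p (k + 1) l = p (k + 1) j').card := by
      apply Finset.card_le_card_of_injOn fun l => if hl : l.1 + 1 < m then ⟨l + 1, hl⟩ else l
      · intro l hl
        simp only [Finset.coe_filter, Finset.mem_univ, true_and, Set.mem_ofPred_eq] at hl ⊢
        have hlt : (l : ℕ) < j := hl.1
        have hlm : l.1 + 1 < m := by omega
        rw [dif_pos hlm]
        have hlt' : (⟨l + 1, hlm⟩ : Fin m) < j' := show l.1 + 1 < (j' : ℕ) by omega
        have := hd l ⟨l + 1, hlm⟩ rfl
        have := ha' hlt'.le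
        exact ⟨hlt', by linarith [hl.2]⟩
      · intro l hl l' hl' hll
        simp only [Finset.coe_filter, Finset.mem_univ, true_and, Set.mem_ofPred_eq] at hl hl'
        have h3 : (l : ℕ) < j := hl.1
        have h4 : (l' : ℕ) < j := hl'.1
        simp only [show l.1 + 1 < m by omega, show l'.1 + 1 < m by omega, dif_pos,
          Fin.mk.injEq] at hll
        ext
        omega
    have h1' := (Nat.cast_le (α := ℝ)).mpr h1
    have h2' := (Nat.cast_le (α := ℝ)).mpr h2
    linarith

open Filter Topology in
/-- If all the rows above row `i` are integral and the non-integral entries of row `i` are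
distinct, the same can be achieved in the lower rows by a perturbation. -/
lemma exists_mem_injective (hlam : Antitone lam) (hp : p ∈ flaggedGTPolytope n lam mu nu a b)
    {i : ℕ} (hi : i < n) (hint : ∀ k, i < k → ∀ j, IsIntegerReal (p k j)) :
    ∃ x ∈ flaggedGTPolytope n lam mu nu a b, (∀ k, i ≤ k → x k = p k) ∧
      ∀ k j j', ¬ IsIntegerReal (x k j) → x k j = x k j' → j = j' := by
  have hT := isTangent_spread hlam hp hi.le hint
  have hdist : ∀ {j j'}, ¬ IsIntegerReal (p i j) → p i j = p i j' → j = j' :=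
    eq_of_isIntegerReal_succ hlam hp hi (hint (i + 1) (Nat.lt_succ_self i))
  have hrow : ∀ k, i ≤ k → spread p k = 0 := by
    intro k hk
    ext j
    rcases hk.eq_or_lt with rfl | hk
    · by_cases hj : IsIntegerReal (p i j)
      · exact spread_of_isIntegerReal hj
      · rw [spread_of_not_isIntegerReal hj, Finset.filter_false_of_mem,
          Finset.filter_false_of_mem]
        · simp
        · rintro l - ⟨hl, h⟩
          exact hl.ne' (hdist hj h.symm)
        · rintro l - ⟨hl, h⟩
          exact hl.ne (hdist hj h.symm)
    · exact hT.zero k hk j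
  have ev : ∀ᶠ ε in 𝓝[>] (0 : ℝ), ∀ k ∈ Finset.range i, ∀ j j' : Fin m,
      ¬ IsIntegerReal (p k j) → j ≠ j' →
        p k j + ε * spread p k j ≠ p k j' + ε * spread p k j' := by
    rw [Filter.eventually_all_finset]
    intro k _
    rw [Filter.eventually_all]
    intro j
    rw [Filter.eventually_all]
    intro j'
    rw [Filter.eventually_imp_distrib_left]
    intro hj
    rw [Filter.eventually_imp_distrib_left]
    intro hjj'
    refine eventually_add_mul_ne fun h => ?_
    rcases lt_or_gt_of_ne hjj' with hlt | hlt
    · exact (spread_lt_spread hj h hlt).ne'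
    · exact (spread_lt_spread (h ▸ hj) h.symm hlt).ne
  obtain ⟨ε, hmem, hne⟩ := ((hT.eventually_add_smul_mem hp hint).and ev).exists
  refine ⟨_, hmem, fun k hk => by ext j; simp [hrow k hk], fun k j j' hj h => ?_⟩
  simp only [Pi.add_apply, Pi.smul_apply, smul_eq_mul] at hj h
  rcases lt_or_ge k i with hk | hk
  · by_contra hjj'
    refine hne k (Finset.mem_range.mpr hk) j j' (fun hI => hj ?_) hjj' h
    simpa [spread_of_isIntegerReal hI] using hI
  · simp only [hrow k hk, Pi.zero_apply, mul_zero, add_zero] at hj h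
    rcases hk.eq_or_lt with rfl | hk
    · exact hdist hj h
    · exact (hj (hint k hk j)).elim

open Filter Topology in
lemma IsLexSmallest.isIntegerReal (hlam : Antitone lam)
    (hp : IsLexSmallest n (flaggedGTPolytope n lam mu nu a b) p) (i : ℕ) (j : Fin m) :
    IsIntegerReal (p i j) := by
  have hlex := hp.2
  replace hp := hp.1
  have htop : ∀ i, n ≤ i → ∀ j, IsIntegerReal (p i j) := by
    intro i hi j
    rcases hi.eq_or_lt with rfl | hi
    · rw [hp.1]; exact .natCast _
    · rw [hp.2.2.1 i hi]; exact .natCast _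
  suffices h : ∀ i ≤ n, ∀ k, i ≤ k → ∀ j, IsIntegerReal (p k j) from
    h 0 (Nat.zero_le n) i (Nat.zero_le i) j
  intro i hi
  induction hi using Nat.decreasingInduction with
  | self => exact htop
  | of_succ i hi ih =>
    intro k hk j₀
    rcases hk.eq_or_lt with rfl | hk
    swap
    · exact ih k hk j₀
    by_contra hj₀
    obtain ⟨x, hx, hxp, hdist⟩ := exists_mem_injective hlam hp hi ih
    classical
    set N := Finset.univ.filter fun j => ¬ IsIntegerReal (p i j) with hN
    have hNne : N.Nonempty := ⟨j₀, by simpa [hN] using hj₀⟩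
    set j := N.max' hNne with hjmax
    have hj : ¬ IsIntegerReal (p i j) := (Finset.mem_filter.mp (N.max'_mem hNne)).2
    have hnot : ¬ IsIntegerReal (∑ l ∈ {j}, x i l) := by simpa [hxp i le_rfl] using hj
    have hex : ∃ j', ¬ IsIntegerReal (x i j') ∧ j' ≠ j ∧
        ∃ d, IsTangent x i d ∧ d i = Pi.single j 1 - Pi.single j' 1 := by
      by_contra hcon
      push Not at hcon
      refine hnot (isIntegerReal_sum_of_closed x n (fun l => by rw [hx.2.1]; exact .natCast _)
        (fun k hk => isIntegerReal_row_sum hx hk) hdist i hi.le {j} ?_ ?_)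
      · simpa [hxp i le_rfl] using hj
      · rintro l hl j' hj' hj'j ⟨d, hd, hdi⟩
        obtain rfl := Finset.mem_singleton.mp hl
        exact hcon j' hj' (by simpa using hj'j) d hd hdi
    obtain ⟨j', hj', hne, d, hd, hdi⟩ := hex
    have hlt : j' < j := lt_of_le_of_ne
      (N.le_max' j' (by simpa [hN, hxp i le_rfl] using hj')) hne
    have hxint : ∀ k, i < k → ∀ l, IsIntegerReal (x k l) := fun k hk l => by
      rw [hxp k hk.le]; exact ih k hk l
    obtain ⟨ε, hmem, hε⟩ :=
      ((hd.eventually_add_smul_mem hx hxint).and self_mem_nhdsWithin).exists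
    have hε' : (0 : ℝ) < ε := hε
    have habove : ∀ k, i < k → ∀ l, (x + ε • d) k l = p k l := fun k hk l => by
      simp [hd.zero k hk l, hxp k hk.le]
    have hrow : ∀ l, (x + ε • d) i l =
        p i l + ε * ((if l = j then 1 else 0) - if l = j' then 1 else 0) := fun l => by
      simp [hdi, hxp i le_rfl, Pi.single_apply]
    have hdrop : (x + ε • d) i j' < p i j' := by
      rw [hrow, if_neg hne, if_pos rfl]
      linarith
    obtain ⟨t, l, ht, hpq, heq⟩ := hlex _ hmem fun h => by
      rw [h] at hdrop
      exact lt_irrefl _ hdrop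
    rcases lt_trichotomy t (n - i) with h | rfl | h
    · exact hpq.ne' (habove _ (by omega) l)
    · rw [Nat.sub_sub_self hi.le] at hpq
      rcases lt_trichotomy l j' with hl | rfl | hl
      · rw [hrow, if_neg (hl.trans hlt).ne, if_neg hl.ne] at hpq
        simp at hpq
      · exact lt_asymm hpq hdrop
      · have := heq (n - i) j' ht (Or.inr ⟨rfl, hl⟩)
        rw [Nat.sub_sub_self hi.le] at this
        exact hdrop.ne' this
    · have := heq (n - i) j' (by omega) (Or.inl h)
      rw [Nat.sub_sub_self hi.le] at this
      exact hdrop.ne' this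

end LexMin

theorem flaggedGT_lex_min_integral_vertex {m : ℕ} (n : ℕ)
    (lam mu : Fin m → ℕ) (nu : ℕ → ℕ) (a b : Fin m → ℕ)
    (hlam : Antitone lam) (hmu : Antitone mu) (hsub : ∀ j, mu j ≤ lam j)
    (ha : Monotone a) (hb : Monotone b)
    (hne : (flaggedGTPolytope n lam mu nu a b).Nonempty) :
    ∃ p, IsLexSmallest n (flaggedGTPolytope n lam mu nu a b) p ∧
      p ∈ Set.extremePoints ℝ (flaggedGTPolytope n lam mu nu a b) ∧
      ∀ (i : ℕ) (j : Fin m), ∃ z : ℤ, p i j = (z : ℝ) := by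
  obtain ⟨p, hp⟩ := exists_isLexSmallest hne
  exact ⟨p, hp, hp.mem_extremePoints, hp.isIntegerReal hlam⟩
end
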